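/- Let M = N ⊗̄ P be a tensor product of von Neumann algebras, φ_N ∈ N_* and φ_P ∈ P_* faithful normal states, and φ_M = φ_N ⊗ φ_P ∈ M_*. Then the triple (M, N, φ_M), where N ⊂ M via N ⊗ ℂ1 with conditional expectation E = id_N ⊗ φ_P, is intertwining stable. -/

import Mathlib

/-!
Common framework for formalizing Houdayer–Isono,
"Pointwise inner automorphisms of almost periodic factors".

Von Neumann algebras are modeled concretely, following Mathlib, as
`VonNeumannAlgebra H` for a complex Hilbert space `H`.  Notions that are not
available in Mathlib (normal states and weights, modular automorphism groups,
Connes cocycles, tensor/free product decompositions, …) are modeled by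
explicit predicates/structures whose fields record their standard
characterizing properties (e.g. the modular group of a state is characterized
as the pointwise SOT-continuous one-parameter automorphism group satisfying
the KMS condition).
-/

open scoped ComplexOrder ENNReal

namespace HSC

variable {H : Type} [NormedAddCommGroup H] [InnerProductSpace ℂ H] [CompleteSpace H]

/-- The bounded operators on the Hilbert space `H`. -/
abbrev Op (H : Type) [NormedAddCommGroup H] [InnerProductSpace ℂ H] [CompleteSpace H] : Type :=
  H →L[ℂ] H

/-- Positivity of a bounded operator on a Hilbert space. -/
def IsPos (x : Op H) : Prop := ContinuousLinearMap.IsPositive x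

/-- `p` is an (orthogonal) projection belonging to the set `A` of operators. -/
def IsProjIn (A : Set (Op H)) (p : Op H) : Prop := p ∈ A ∧ star p = p ∧ p * p = p

/-- `u` is a unitary belonging to the set `A` of operators. -/
def IsUnitaryIn (A : Set (Op H)) (u : Op H) : Prop := u ∈ A ∧ star u * u = 1 ∧ u * star u = 1

/-- `v` is a partial isometry. -/
def IsPartialIsom (v : Op H) : Prop := star v * v * (star v * v) = star v * v

/-- `φ` is a positive linear functional on `M` (recorded as a function on all of `B(H)`;
only its values on `M` matter). -/
structure IsPLF (M : VonNeumannAlgebra H) (φ : Op H → ℂ) : Prop where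
  map_add : ∀ x ∈ M, ∀ y ∈ M, φ (x + y) = φ x + φ y
  map_smul : ∀ (c : ℂ), ∀ x ∈ M, φ (c • x) = c * φ x
  pos : ∀ x ∈ M, 0 ≤ φ (star x * x)

/-- `φ` is a *normal* positive linear functional on `M`: a positive linear functional which is
completely additive on orthogonal families of projections (sums taken in the strong topology). -/
structure IsNormalPLF (M : VonNeumannAlgebra H) (φ : Op H → ℂ) extends IsPLF M φ : Prop where
  normal : ∀ (ι : Type) (p : ι → Op H) (q : Op H),
    (∀ i, IsProjIn (M : Set (Op H)) (p i)) → IsProjIn (M : Set (Op H)) q →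
    (Pairwise fun i j => p i * p j = 0) →
    (∀ ξ : H, HasSum (fun i => p i ξ) (q ξ)) →
    HasSum (fun i => φ (p i)) (φ q)

/-- `φ` is a normal state on `M`. -/
def IsNormalState (M : VonNeumannAlgebra H) (φ : Op H → ℂ) : Prop :=
  IsNormalPLF M φ ∧ φ 1 = 1

/-- Faithfulness of a positive linear functional on `M`. -/
def IsFaithfulOn (M : VonNeumannAlgebra H) (φ : Op H → ℂ) : Prop :=
  ∀ x ∈ M, φ (star x * x) = 0 → x = 0

/-- `φ` is a faithful normal state on `M`. -/
def IsFNState (M : VonNeumannAlgebra H) (φ : Op H → ℂ) : Prop :=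
  IsNormalState M φ ∧ IsFaithfulOn M φ

/-- `p` is the support projection `s(φ)` of `φ` in `M`: the smallest projection of `M`
compressing to which does not change `φ`. -/
def IsSupportProjOf (M : VonNeumannAlgebra H) (φ : Op H → ℂ) (p : Op H) : Prop :=
  IsProjIn (M : Set (Op H)) p ∧ (∀ x ∈ M, φ (p * x * p) = φ x) ∧
    ∀ q, IsProjIn (M : Set (Op H)) q → (∀ x ∈ M, φ (q * x * q) = φ x) → p * q = p

/-- `ψ ∼_M φ` : the normal positive functionals `ψ` and `φ` are intertwined in `M`,
i.e. there are a nonzero partial isometry `v ∈ s(ψ) M s(φ)` and `l > 0` with `ψ v = l v φ`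
(with the bimodule conventions `(ψ v)(x) = ψ(vx)`, `(v φ)(x) = φ(xv)`). -/
def Intertwined (M : VonNeumannAlgebra H) (ψ φ : Op H → ℂ) : Prop :=
  ∃ (v q p : Op H) (l : ℝ), 0 < l ∧ v ∈ M ∧ IsPartialIsom v ∧ v ≠ 0 ∧
    IsSupportProjOf M ψ q ∧ IsSupportProjOf M φ p ∧ q * v = v ∧ v * p = v ∧
    ∀ x ∈ M, ψ (v * x) = (l : ℂ) * φ (x * v)

/-- An automorphism of the von Neumann algebra `M` (automatically normal). -/
structure VNAut (M : VonNeumannAlgebra H) where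
  toFun : Op H → Op H
  invFun : Op H → Op H
  mem' : ∀ x ∈ M, toFun x ∈ M
  inv_mem' : ∀ x ∈ M, invFun x ∈ M
  left_inv' : ∀ x ∈ M, invFun (toFun x) = x
  right_inv' : ∀ x ∈ M, toFun (invFun x) = x
  map_add' : ∀ x ∈ M, ∀ y ∈ M, toFun (x + y) = toFun x + toFun y
  map_smul' : ∀ (c : ℂ), ∀ x ∈ M, toFun (c • x) = c • toFun x
  map_mul' : ∀ x ∈ M, ∀ y ∈ M, toFun (x * y) = toFun x * toFun y
  map_star' : ∀ x ∈ M, toFun (star x) = star (toFun x)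

/-- `Θ` is pointwise inner: for every normal state `ψ` there is a unitary `u ∈ M` with
`Θ(ψ) = u ψ u*`, i.e. `ψ(Θ⁻¹(x)) = ψ(u* x u)` for all `x ∈ M`. -/
def PointwiseInner {M : VonNeumannAlgebra H} (Θ : VNAut M) : Prop :=
  ∀ ψ : Op H → ℂ, IsNormalState M ψ →
    ∃ u, IsUnitaryIn (M : Set (Op H)) u ∧
      ∀ x ∈ M, ψ (Θ.invFun x) = ψ (star u * x * u)

/-- The closed horizontal strip `0 ≤ Im z ≤ 1`. -/
def strip : Set ℂ := {z | 0 ≤ z.im ∧ z.im ≤ 1}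

/-- The open horizontal strip `0 < Im z < 1`. -/
def stripo : Set ℂ := {z | 0 < z.im ∧ z.im < 1}

/-- `σ` is the modular automorphism group `σ^φ` of the (faithful normal) state `φ` on `M`:
a pointwise SOT-continuous one-parameter group of ∗-automorphisms of `M` preserving `φ` and
satisfying the KMS condition at inverse temperature 1. -/
structure IsModularFlow (M : VonNeumannAlgebra H) (φ : Op H → ℂ) (σ : ℝ → Op H → Op H) :
    Prop where
  mem' : ∀ (t : ℝ), ∀ x ∈ M, σ t x ∈ M
  zero' : ∀ x ∈ M, σ 0 x = x
  add' : ∀ (s t : ℝ), ∀ x ∈ M, σ (s + t) x = σ s (σ t x)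
  map_add' : ∀ (t : ℝ), ∀ x ∈ M, ∀ y ∈ M, σ t (x + y) = σ t x + σ t y
  map_smul' : ∀ (t : ℝ) (c : ℂ), ∀ x ∈ M, σ t (c • x) = c • σ t x
  map_mul' : ∀ (t : ℝ), ∀ x ∈ M, ∀ y ∈ M, σ t (x * y) = σ t x * σ t y
  map_star' : ∀ (t : ℝ), ∀ x ∈ M, σ t (star x) = star (σ t x)
  invariant' : ∀ (t : ℝ), ∀ x ∈ M, φ (σ t x) = φ x
  continuous' : ∀ x ∈ M, ∀ ξ : H, Continuous fun t : ℝ => σ t x ξ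
  kms' : ∀ x ∈ M, ∀ y ∈ M, ∃ F : ℂ → ℂ, ContinuousOn F strip ∧
    DifferentiableOn ℂ F stripo ∧ (∃ C : ℝ, ∀ z ∈ strip, ‖F z‖ ≤ C) ∧
    (∀ t : ℝ, F (t : ℂ) = φ (σ t x * y)) ∧
    (∀ t : ℝ, F ((t : ℂ) + Complex.I) = φ (y * σ t x))

/-- `l ^ (i t)` for `l > 0`. -/
noncomputable def cpowit (l t : ℝ) : ℂ := Complex.exp (Complex.I * t * Real.log l)

/-- `x ∈ M` is an `l`-eigenvector of the modular flow `σ`, i.e. `σ_t(x) = l^{it} x`. -/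
def IsEigenvector (M : VonNeumannAlgebra H) (σ : ℝ → Op H → Op H) (l : ℝ) (x : Op H) :
    Prop :=
  x ∈ M ∧ ∀ t : ℝ, σ t x = cpowit l t • x

/-- The point spectrum `σ_p(Δ_φ)` of the modular operator, described via eigenvectors in `M`. -/
def pointSpectrum (M : VonNeumannAlgebra H) (σ : ℝ → Op H → Op H) : Set ℝ :=
  {l | 0 < l ∧ ∃ x, x ≠ 0 ∧ IsEigenvector M σ l x}

/-- The linear span of the eigenvectors of the modular flow. -/
def eigenSpan (M : VonNeumannAlgebra H) (σ : ℝ → Op H → Op H) : Submodule ℂ (Op H) :=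
  Submodule.span ℂ {x | ∃ l : ℝ, 0 < l ∧ IsEigenvector M σ l x}

/-- Almost periodicity of `φ` (via its modular flow `σ`): the linear span of the
eigenvectors is ∗-strongly dense in `M`. -/
def IsAlmostPeriodicFlow (M : VonNeumannAlgebra H) (σ : ℝ → Op H → Op H) : Prop :=
  ∀ x ∈ M, ∀ ε : ℝ, 0 < ε → ∀ Ξ : Finset H, ∃ y ∈ eigenSpan M σ,
    ∀ ξ ∈ Ξ, ‖(x - y) ξ‖ < ε ∧ ‖(star x - star y) ξ‖ < ε

/-- The centralizer `M_φ` of a state `φ` on `M`. -/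
def stateCentralizer (M : VonNeumannAlgebra H) (φ : Op H → ℂ) : Set (Op H) :=
  {x | x ∈ M ∧ ∀ y ∈ M, φ (x * y) = φ (y * x)}

/-- The fixed-point algebra of the flow `σ` on `M` (`= M_φ` for the modular flow of a weight). -/
def flowFixed (M : VonNeumannAlgebra H) (σ : ℝ → Op H → Op H) : Set (Op H) :=
  {x | x ∈ M ∧ ∀ t : ℝ, σ t x = x}

/-- A set of operators (e.g. a von Neumann subalgebra) has trivial center. -/
def IsFactorSet (A : Set (Op H)) : Prop :=
  ∀ x ∈ A, (∀ y ∈ A, x * y = y * x) → ∃ c : ℂ, x = c • (1 : Op H)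

/-- `M` is a factor. -/
def IsFactor (M : VonNeumannAlgebra H) : Prop := IsFactorSet (M : Set (Op H))

/-- Murray–von Neumann equivalence of projections, relative to the set `A`. -/
def MvNEquivIn (A : Set (Op H)) (p q : Op H) : Prop :=
  ∃ v ∈ A, star v * v = p ∧ v * star v = q

/-- `p` is a finite projection relative to `A`: no proper subprojection of `p`
is Murray–von Neumann equivalent (in `A`) to `p`. -/
def IsFiniteProjIn (A : Set (Op H)) (p : Op H) : Prop :=
  ∀ q, IsProjIn A q → q * p = q → MvNEquivIn A p q → q = p

/-- `p` is a minimal projection relative to `A`. -/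
def IsMinimalProjIn (A : Set (Op H)) (p : Op H) : Prop :=
  IsProjIn A p ∧ p ≠ 0 ∧ ∀ q, IsProjIn A q → q * p = q → q = 0 ∨ q = p

/-- `M` is a type III factor: a factor with no nonzero finite projection. -/
def IsTypeIIIFactor (M : VonNeumannAlgebra H) : Prop :=
  IsFactor M ∧
    ∀ p, IsProjIn (M : Set (Op H)) p → p ≠ 0 → ¬ IsFiniteProjIn (M : Set (Op H)) p

/-- The ∗-closed set `A` (e.g. a corner or a subalgebra) is a type II₁ factor:
trivial center, `1` finite, and no minimal projections. -/
def IsTypeII1FactorSet (A : Set (Op H)) : Prop :=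
  IsFactorSet A ∧ (1 : Op H) ∈ A ∧ IsFiniteProjIn A 1 ∧ ∀ p, ¬ IsMinimalProjIn A p

/-- `A` is a type I_∞ factor (model for `B(ℓ²)`): a factor with a minimal projection
whose unit is not finite. -/
def IsTypeIInfFactorSet (A : Set (Op H)) : Prop :=
  IsFactorSet A ∧ (1 : Op H) ∈ A ∧ (∃ p, IsMinimalProjIn A p) ∧ ¬ IsFiniteProjIn A 1

/-- `M` is a type III₁ factor.  By the Connes–Størmer transitivity theorem, among
type III factors with separable predual, type III₁ is characterized by the topological
transitivity of the unitary group action on faithful normal states. -/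
def IsTypeIII1Factor (M : VonNeumannAlgebra H) : Prop :=
  IsTypeIIIFactor M ∧
    ∀ φ ψ : Op H → ℂ, IsFNState M φ → IsFNState M ψ → ∀ ε : ℝ, 0 < ε →
      ∃ u, IsUnitaryIn (M : Set (Op H)) u ∧
        ∀ x ∈ M, ‖x‖ ≤ 1 → ‖φ (star u * x * u) - ψ x‖ < ε

/-- `M` is injective (= amenable, = hyperfinite by Connes' theorem):
there is a norm-one projection `B(H) → M`. -/
def IsInjectiveVNA (M : VonNeumannAlgebra H) : Prop :=
  ∃ E : Op H →ₗ[ℂ] Op H, (∀ x, E x ∈ M) ∧ (∀ x ∈ M, E x = x) ∧ ∀ x, ‖E x‖ ≤ ‖x‖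

/-- `M` is (a copy of) the Araki–Woods factor `R_∞`: the unique amenable (injective)
type III₁ factor with separable predual. -/
def IsArakiWoodsRInfty (M : VonNeumannAlgebra H) : Prop :=
  IsTypeIII1Factor M ∧ IsInjectiveVNA M

/-- Data of a faithful normal semifinite weight: its value `val` on positive elements
(in `[0,∞]`), together with a linear extension `cval` of its restriction to the
definition ideal `m_φ` (the values of `cval` outside `m_φ` are irrelevant). -/
structure WeightData (H : Type) [NormedAddCommGroup H] [InnerProductSpace ℂ H]
    [CompleteSpace H] where
  val : Op H → ℝ≥0∞
  cval : Op H → ℂ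

/-- `W` is a faithful normal semifinite weight on `M`. -/
structure IsFNSWeight (M : VonNeumannAlgebra H) (W : WeightData H) : Prop where
  map_add : ∀ x ∈ M, ∀ y ∈ M, IsPos x → IsPos y → W.val (x + y) = W.val x + W.val y
  map_smul : ∀ c : ℝ, 0 < c → ∀ x ∈ M, IsPos x →
    W.val ((c : ℂ) • x) = ENNReal.ofReal c * W.val x
  faithful : ∀ x ∈ M, IsPos x → W.val x = 0 → x = 0
  semifinite : ∀ x ∈ M, IsPos x → x ≠ 0 →
    ∃ y ∈ M, IsPos y ∧ y ≠ 0 ∧ IsPos (x - y) ∧ W.val y ≠ ⊤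
  normal : ∀ (ι : Type) (p : ι → Op H) (q : Op H),
    (∀ i, IsProjIn (M : Set (Op H)) (p i)) → IsProjIn (M : Set (Op H)) q →
    (Pairwise fun i j => p i * p j = 0) →
    (∀ ξ : H, HasSum (fun i => p i ξ) (q ξ)) →
    W.val q = ∑' i, W.val (p i)
  cval_add : ∀ x ∈ M, ∀ y ∈ M, W.cval (x + y) = W.cval x + W.cval y
  cval_smul : ∀ (c : ℂ), ∀ x ∈ M, W.cval (c • x) = c * W.cval x
  cval_compat : ∀ x ∈ M, IsPos x → W.val x ≠ ⊤ → W.cval x = ((W.val x).toReal : ℂ)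

/-- `σ` is the modular automorphism group `σ^φ` of the faithful normal semifinite
weight `W` on `M` (KMS condition required on the definition ideal). -/
structure IsModularFlowW (M : VonNeumannAlgebra H) (W : WeightData H)
    (σ : ℝ → Op H → Op H) : Prop where
  mem' : ∀ (t : ℝ), ∀ x ∈ M, σ t x ∈ M
  zero' : ∀ x ∈ M, σ 0 x = x
  add' : ∀ (s t : ℝ), ∀ x ∈ M, σ (s + t) x = σ s (σ t x)
  map_add' : ∀ (t : ℝ), ∀ x ∈ M, ∀ y ∈ M, σ t (x + y) = σ t x + σ t y
  map_smul' : ∀ (t : ℝ) (c : ℂ), ∀ x ∈ M, σ t (c • x) = c • σ t x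
  map_mul' : ∀ (t : ℝ), ∀ x ∈ M, ∀ y ∈ M, σ t (x * y) = σ t x * σ t y
  map_star' : ∀ (t : ℝ), ∀ x ∈ M, σ t (star x) = star (σ t x)
  invariant' : ∀ (t : ℝ), ∀ x ∈ M, IsPos x → W.val (σ t x) = W.val x
  continuous' : ∀ x ∈ M, ∀ ξ : H, Continuous fun t : ℝ => σ t x ξ
  kms' : ∀ x ∈ M, ∀ y ∈ M,
    W.val (star x * x) ≠ ⊤ → W.val (x * star x) ≠ ⊤ →
    W.val (star y * y) ≠ ⊤ → W.val (y * star y) ≠ ⊤ →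
    ∃ F : ℂ → ℂ, ContinuousOn F strip ∧ DifferentiableOn ℂ F stripo ∧
      (∃ C : ℝ, ∀ z ∈ strip, ‖F z‖ ≤ C) ∧
      (∀ t : ℝ, F (t : ℂ) = W.cval (σ t x * y)) ∧
      (∀ t : ℝ, F ((t : ℂ) + Complex.I) = W.cval (y * σ t x))

/-- The weight `W` is strictly semifinite: its restriction to the centralizer
(= fixed points of the modular flow `σ`) is semifinite. -/
def IsStrictlySemifiniteOn (M : VonNeumannAlgebra H) (W : WeightData H)
    (σ : ℝ → Op H → Op H) : Prop :=
  ∀ x ∈ flowFixed M σ, IsPos x → x ≠ 0 →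
    ∃ y ∈ flowFixed M σ, IsPos y ∧ y ≠ 0 ∧ IsPos (x - y) ∧ W.val y ≠ ⊤

/-- `h` is a positive element of the corner `pAp`, invertible in this corner. -/
def CornerPosInvertibleIn (A : Set (Op H)) (p h : Op H) : Prop :=
  h ∈ A ∧ IsPos h ∧ p * h = h ∧ h * p = h ∧
    ∃ h' ∈ A, p * h' = h' ∧ h' * p = h' ∧ h * h' = p ∧ h' * h = p

/-- `Θ` is locally pointwise inner for the strictly semifinite weight `W` (with modular flow
`σ`): `Θ(φ) = φ`, and for every nonzero projection `p ∈ M_φ` with `φ(p) < ∞` and every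
positive invertible `h ∈ pM_φp` one has `Θ(φ_h) ∼_M φ_h`, where `φ_h = φ(h^{1/2}·h^{1/2})`
(below `k = h^{1/2}` is the positive square root of `h` in `M_φ`). -/
def LocallyPointwiseInnerW {M : VonNeumannAlgebra H} (W : WeightData H)
    (σ : ℝ → Op H → Op H) (Θ : VNAut M) : Prop :=
  (∀ x ∈ M, IsPos x → W.val (Θ.invFun x) = W.val x) ∧
  ∀ p, IsProjIn (flowFixed M σ) p → p ≠ 0 → W.val p ≠ ⊤ →
  ∀ h, CornerPosInvertibleIn (flowFixed M σ) p h →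
  ∀ k, k ∈ flowFixed M σ → IsPos k → k * k = h →
    Intertwined M (fun x => W.cval (k * Θ.invFun x * k)) (fun x => W.cval (k * x * k))

/-- `Θ` is locally pointwise inner for the faithful normal state `φ` with modular flow `σ`. -/
def LocallyPointwiseInnerS {M : VonNeumannAlgebra H} (φ : Op H → ℂ)
    (σ : ℝ → Op H → Op H) (Θ : VNAut M) : Prop :=
  (∀ x ∈ M, φ (Θ.invFun x) = φ x) ∧
  ∀ p, IsProjIn (flowFixed M σ) p → p ≠ 0 →
  ∀ h, CornerPosInvertibleIn (flowFixed M σ) p h →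
  ∀ k, k ∈ flowFixed M σ → IsPos k → k * k = h →
    Intertwined M (fun x => φ (k * Θ.invFun x * k)) (fun x => φ (k * x * k))

/-- `Θ` is locally pointwise inner for the faithful normal state `φ`, stated with the
algebraically-defined centralizer `M_φ = {x : φ(xy) = φ(yx)}`. -/
def LocallyPointwiseInnerC {M : VonNeumannAlgebra H} (φ : Op H → ℂ) (Θ : VNAut M) : Prop :=
  (∀ x ∈ M, φ (Θ.invFun x) = φ x) ∧
  ∀ p, IsProjIn (stateCentralizer M φ) p → p ≠ 0 →
  ∀ h, CornerPosInvertibleIn (stateCentralizer M φ) p h →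
  ∀ k, k ∈ stateCentralizer M φ → IsPos k → k * k = h →
    Intertwined M (fun x => φ (k * Θ.invFun x * k)) (fun x => φ (k * x * k))

/-- `E : M → N` is a faithful normal conditional expectation. -/
structure IsCondExp (M N : VonNeumannAlgebra H) (E : Op H → Op H) : Prop where
  subset' : (N : Set (Op H)) ⊆ (M : Set (Op H))
  mem' : ∀ x ∈ M, E x ∈ N
  fix' : ∀ x ∈ N, E x = x
  map_add' : ∀ x ∈ M, ∀ y ∈ M, E (x + y) = E x + E y
  map_smul' : ∀ (c : ℂ), ∀ x ∈ M, E (c • x) = c • E x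
  bimod' : ∀ a ∈ N, ∀ x ∈ M, ∀ b ∈ N, E (a * x * b) = a * E x * b
  map_star' : ∀ x ∈ M, E (star x) = star (E x)
  pos' : ∀ x ∈ M, IsPos x → IsPos (E x)
  faithful' : ∀ x ∈ M, IsPos x → E x = 0 → x = 0
  normal' : ∀ ρ : Op H → ℂ, IsNormalState N ρ → IsNormalState M (fun x => ρ (E x))

/-- The triple `(M, N, φ)` (with expectation `E : M → N`, `φ ∘ E = φ`) is
intertwining stable (Definition 4.1 of Houdayer–Isono). -/
def IntertwiningStable (M N : VonNeumannAlgebra H) (E : Op H → Op H)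
    (φ : Op H → ℂ) : Prop :=
  ∀ Θ : VNAut M,
    (∀ x ∈ M, E (Θ.toFun x) = Θ.toFun (E x)) →
    (∀ x ∈ M, φ (Θ.invFun x) = φ x) →
    ∀ ψ : Op H → ℂ, IsNormalPLF N ψ → (∃ x ∈ N, ψ x ≠ 0) →
      Intertwined M (fun x => ψ (E (Θ.invFun x))) (fun x => ψ (E x)) →
      Intertwined N (fun x => ψ (Θ.invFun x)) ψ

/-- `M = N ⊗̄ P`: `N` and `P` are commuting subalgebras of `M` which generate `M`
and admit normal product states (slice maps). -/
structure IsTensorDecomposition (M N P : VonNeumannAlgebra H) : Prop where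
  subN : (N : Set (Op H)) ⊆ (M : Set (Op H))
  subP : (P : Set (Op H)) ⊆ (M : Set (Op H))
  comm : ∀ x ∈ N, ∀ y ∈ P, x * y = y * x
  generates :
    Set.centralizer (Set.centralizer ((N : Set (Op H)) ∪ (P : Set (Op H)))) = (M : Set (Op H))
  slice : ∀ (ρN ρP : Op H → ℂ), IsNormalState N ρN → IsNormalState P ρP →
    ∃ ρ : Op H → ℂ, IsNormalState M ρ ∧ ∀ x ∈ N, ∀ y ∈ P, ρ (x * y) = ρN x * ρP y

/-- `E = id_N ⊗ φ_P : N ⊗̄ P → N` is the slice conditional expectation attached to `φ_P`. -/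
def IsSliceExpectation (M N P : VonNeumannAlgebra H) (φP : Op H → ℂ)
    (E : Op H → Op H) : Prop :=
  IsCondExp M N E ∧ ∀ x ∈ N, ∀ y ∈ P, E (x * y) = φP y • x

/-- `(M, φ) = (N, φN) ∗ (P, φP)`: `N` and `P` are subalgebras of `M` which generate `M`,
the state `φ` restricts to `φN`, `φP`, and `N`, `P` are free with respect to `φ`. -/
structure IsFreeProductDecomposition (M N P : VonNeumannAlgebra H)
    (φ φN φP : Op H → ℂ) : Prop where
  subN : (N : Set (Op H)) ⊆ (M : Set (Op H))
  subP : (P : Set (Op H)) ⊆ (M : Set (Op H))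
  generates :
    Set.centralizer (Set.centralizer ((N : Set (Op H)) ∪ (P : Set (Op H)))) = (M : Set (Op H))
  restN : ∀ x ∈ N, φ x = φN x
  restP : ∀ x ∈ P, φ x = φP x
  free : ∀ (n : ℕ) (x : Fin n → Op H) (ε : Fin n → Bool), n ≠ 0 →
    (∀ i, x i ∈ (if ε i then (N : Set (Op H)) else (P : Set (Op H)))) →
    (∀ i, φ (x i) = 0) →
    (∀ i j : Fin n, (i : ℕ) + 1 = (j : ℕ) → ε i ≠ ε j) →
    φ (List.ofFn x).prod = 0

/-- `f` restricts to a ∗-isomorphism `N ≅ P`. -/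
structure IsVNIso (N P : VonNeumannAlgebra H) (f : Op H → Op H) : Prop where
  mem' : ∀ x ∈ N, f x ∈ P
  surj' : ∀ y ∈ P, ∃ x ∈ N, f x = y
  inj' : ∀ x ∈ N, ∀ y ∈ N, f x = f y → x = y
  map_add' : ∀ x ∈ N, ∀ y ∈ N, f (x + y) = f x + f y
  map_smul' : ∀ (c : ℂ), ∀ x ∈ N, f (c • x) = c • f x
  map_mul' : ∀ x ∈ N, ∀ y ∈ N, f (x * y) = f x * f y
  map_star' : ∀ x ∈ N, f (star x) = star (f x)

/-- `M` satisfies the Haagerup–Størmer conjecture: an automorphism of `M` is pointwise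
inner iff it is the composition of an inner automorphism and a modular automorphism
`σ_t^χ` of some faithful normal state `χ`. -/
def SatisfiesHSC (M : VonNeumannAlgebra H) : Prop :=
  ∀ Θ : VNAut M, PointwiseInner Θ ↔
    ∃ (χ : Op H → ℂ) (σ : ℝ → Op H → Op H) (u : Op H) (t : ℝ),
      IsFNState M χ ∧ IsModularFlow M χ σ ∧ IsUnitaryIn (M : Set (Op H)) u ∧
      ∀ x ∈ M, Θ.toFun x = u * σ t x * star u

/-- `Λ` is a countable subgroup of `ℝ_{>0}`, dense in `ℝ_{>0}`. -/
def IsCountableDenseSubgroup (Λ : Set ℝ) : Prop :=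
  Λ ⊆ Set.Ioi (0 : ℝ) ∧ (1 : ℝ) ∈ Λ ∧ (∀ a ∈ Λ, ∀ b ∈ Λ, a * b ∈ Λ) ∧
    (∀ a ∈ Λ, a⁻¹ ∈ Λ) ∧ Λ.Countable ∧ Set.Ioi (0 : ℝ) ⊆ closure Λ

/-- `g` is a character of the (discrete) group `Λ < ℝ_{>0}`, i.e. an element of the dual
compact group `G = Λ̂` (only the values of `g` on `Λ` are relevant). -/
def IsCharacterOn (Λ : Set ℝ) (g : ℝ → ℂ) : Prop :=
  g 1 = 1 ∧ (∀ a ∈ Λ, ‖g a‖ = 1) ∧ ∀ a ∈ Λ, ∀ b ∈ Λ, g (a * b) = g a * g b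

/-- `Φ ∈ E_{M,φ}`: `Φ` is a faithful normal positive linear functional with
`s(φ) ∈ M_Φ` and `Φ s(φ) = s(φ) Φ = φ`. -/
def MemE (M : VonNeumannAlgebra H) (φ Φ : Op H → ℂ) : Prop :=
  IsNormalPLF M Φ ∧ IsFaithfulOn M Φ ∧
    ∃ p, IsSupportProjOf M φ p ∧ (∀ x ∈ M, Φ (p * x) = Φ (x * p)) ∧
      ∀ x ∈ M, Φ (p * x) = φ x

/-- `w = ([DΨ : DΦ]_t)_t` is the Connes Radon–Nikodym cocycle of the pair `(Ψ, Φ)` of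
faithful normal positive functionals (with `σΦ` the modular flow of `Φ`): the unique
σ-strongly continuous family of unitaries satisfying the cocycle identity and the
relative KMS condition. -/
structure IsConnesCocycle (M : VonNeumannAlgebra H) (Φ Ψ : Op H → ℂ)
    (σΦ : ℝ → Op H → Op H) (w : ℝ → Op H) : Prop where
  unitary' : ∀ t : ℝ, IsUnitaryIn (M : Set (Op H)) (w t)
  cocycle' : ∀ s t : ℝ, w (s + t) = w s * σΦ s (w t)
  continuous' : ∀ ξ : H, Continuous fun t : ℝ => w t ξ
  kms' : ∀ x ∈ M, ∀ y ∈ M, ∃ F : ℂ → ℂ, ContinuousOn F strip ∧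
    DifferentiableOn ℂ F stripo ∧ (∃ C : ℝ, ∀ z ∈ strip, ‖F z‖ ≤ C) ∧
    (∀ t : ℝ, F (t : ℂ) = Ψ (w t * σΦ t x * y)) ∧
    (∀ t : ℝ, F ((t : ℂ) + Complex.I) = Φ (y * (w t * σΦ t x)))

/-- `S` is a strongly dense subset of `M`. -/
def StronglyDenseIn (M : VonNeumannAlgebra H) (S : Set (Op H)) : Prop :=
  S ⊆ (M : Set (Op H)) ∧ ∀ x ∈ M, ∀ ε : ℝ, 0 < ε → ∀ Ξ : Finset H,
    ∃ y ∈ S, ∀ ξ ∈ Ξ, ‖(x - y) ξ‖ < ε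

/-- There is a net `(t_j)` in `ℝ` along which `φ(σ_{t_j}^Φ(b^*) w_{t_j}^* s(ψ) a) → 0`
for all `a, b ∈ S` (nets are encoded by maps out of a nontrivially filtered index type). -/
def VanishingNet (φ : Op H → ℂ) (σΦ : ℝ → Op H → Op H) (w : ℝ → Op H)
    (sψ : Op H) (S : Set (Op H)) : Prop :=
  ∃ (ι : Type) (l : Filter ι), l.NeBot ∧ ∃ t : ι → ℝ,
    ∀ a ∈ S, ∀ b ∈ S,
      Filter.Tendsto (fun j => φ (σΦ (t j) (star b) * (star (w (t j)) * (sψ * a))))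
        l (nhds (0 : ℂ))

/-- `(D, π, lam)` is the discrete core `d_{Λ,φ}(M) = M ⋊_{σ^{Λ,φ}} G` of `(M, φ)` with
respect to `Λ = σ_p(Δ_φ)` and `G = Λ̂`: `π` is a normal unital ∗-embedding of `M` into `D`,
`lam` implements `G` by unitaries of `D` satisfying the covariance relation
`λ_g π(x) λ_g^* = ⟨g, l⟩ π(x)` on `l`-eigenvectors, and `π(M)` together with the `λ_g`
generate `D`. -/
structure IsDiscreteCore {K : Type} [NormedAddCommGroup K] [InnerProductSpace ℂ K]
    [CompleteSpace K] (M : VonNeumannAlgebra H) (σ : ℝ → Op H → Op H)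
    (D : VonNeumannAlgebra K) (π : Op H → Op K) (lam : (ℝ → ℂ) → Op K) : Prop where
  mem' : ∀ x ∈ M, π x ∈ D
  inj' : ∀ x ∈ M, ∀ y ∈ M, π x = π y → x = y
  map_one' : π 1 = 1
  map_add' : ∀ x ∈ M, ∀ y ∈ M, π (x + y) = π x + π y
  map_smul' : ∀ (c : ℂ), ∀ x ∈ M, π (c • x) = c • π x
  map_mul' : ∀ x ∈ M, ∀ y ∈ M, π (x * y) = π x * π y
  map_star' : ∀ x ∈ M, π (star x) = star (π x)
  lam_unitary' : ∀ g, IsCharacterOn (pointSpectrum M σ) g →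
    IsUnitaryIn (D : Set (Op K)) (lam g)
  lam_one' : lam (fun _ => 1) = 1
  lam_mul' : ∀ g h, IsCharacterOn (pointSpectrum M σ) g →
    IsCharacterOn (pointSpectrum M σ) h → lam (fun r => g r * h r) = lam g * lam h
  covariance' : ∀ g, IsCharacterOn (pointSpectrum M σ) g →
    ∀ l ∈ pointSpectrum M σ, ∀ x, IsEigenvector M σ l x →
      lam g * π x * star (lam g) = g l • π x
  generates' : Set.centralizer (Set.centralizer
      ((π '' (M : Set (Op H))) ∪ (lam '' {g | IsCharacterOn (pointSpectrum M σ) g})))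
    = (D : Set (Op K))


/-! ### Hilbert spaces attached to positive semidefinite forms -/

/-- Every positive semidefinite sesquilinear form is the pullback of the inner product of a
Hilbert space along a linear map with dense range. -/
theorem exists_hilbert_of_form {V : Type} [AddCommGroup V] [Module ℂ V] (s : V → V → ℂ)
    (hadd : ∀ x y z, s x (y + z) = s x y + s x z) (hsmul : ∀ (c : ℂ) x y, s x (c • y) = c * s x y)
    (hconj : ∀ x y, starRingEnd ℂ (s y x) = s x y) (hpos : ∀ x, 0 ≤ (s x x).re) :
    ∃ (K : Type) (_ : NormedAddCommGroup K) (_ : InnerProductSpace ℂ K) (_ : CompleteSpace K)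
      (j : V →ₗ[ℂ] K), DenseRange j ∧ ∀ x y, inner ℂ (j x) (j y) = s x y := by
  let cd : PreInnerProductSpace.Core ℂ V :=
    { inner := s
      conj_inner_symm := hconj
      re_inner_nonneg := hpos
      add_left := fun x y z => by
        change s (x + y) z = s x z + s y z
        rw [← hconj, hadd, map_add, hconj, hconj]
      smul_left := fun x y c => by
        change s (c • x) y = starRingEnd ℂ c * s x y
        rw [← hconj, hsmul, map_mul, hconj] }
  let := InnerProductSpace.Core.toSeminormedAddCommGroup (𝕜 := ℂ) (F := V)
  let : InnerProductSpace ℂ V := .ofCore cd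
  refine ⟨UniformSpace.Completion V, inferInstance, inferInstance, inferInstance,
    (UniformSpace.Completion.toComplL (𝕜 := ℂ) (E := V)).toLinearMap, ?_, ?_⟩
  · exact UniformSpace.Completion.denseRange_coe
  · intro x y
    exact UniformSpace.Completion.inner_coe x y

/-! ### Positive functionals -/

section PLF

variable {M : VonNeumannAlgebra H} {ψ : Op H → ℂ}

theorem smul_mem_vna (M : VonNeumannAlgebra H) (c : ℂ) {x : Op H} (hx : x ∈ M) : c • x ∈ M :=
  M.toStarSubalgebra.smul_mem hx c

namespace IsPLF

theorem map_zero (h : IsPLF M ψ) : ψ 0 = 0 := by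
  have := h.map_smul 0 0 (zero_mem M)
  simpa using this

theorem map_neg (h : IsPLF M ψ) {x : Op H} (hx : x ∈ M) : ψ (-x) = -ψ x := by
  have := h.map_smul (-1) x hx
  simpa using this

theorem map_sub (h : IsPLF M ψ) {x y : Op H} (hx : x ∈ M) (hy : y ∈ M) :
    ψ (x - y) = ψ x - ψ y := by
  rw [sub_eq_add_neg, h.map_add x hx _ (neg_mem hy), h.map_neg hy, sub_eq_add_neg]

theorem conj_star_mul (h : IsPLF M ψ) {x y : Op H} (hx : x ∈ M) (hy : y ∈ M) :
    starRingEnd ℂ (ψ (star y * x)) = ψ (star x * y) := by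
  have hsx := star_mem hx
  have hsy := star_mem hy
  have im0 : ∀ z ∈ M, (ψ (star z * z)).im = 0 := fun z hz =>
    ((Complex.le_def.1 (h.pos z hz)).2).symm
  have key : ∀ c : ℂ, (c * ψ (star x * y) + starRingEnd ℂ c * ψ (star y * x)).im = 0 := by
    intro c
    have e : star (x + c • y) * (x + c • y) = star x * x + c • (star x * y) +
        ((starRingEnd ℂ c) • (star y * x) + (starRingEnd ℂ c * c) • (star y * y)) := by
      simp only [star_add, star_smul, add_mul, mul_add, smul_mul_assoc, mul_smul_comm,
        Complex.star_def, smul_add, mul_smul]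
      rw [smul_comm c]
      abel
    have h1 := im0 _ (add_mem hx (smul_mem_vna M c hy))
    rw [e, h.map_add _ (add_mem (mul_mem hsx hx) (smul_mem_vna M _ (mul_mem hsx hy))) _
        (add_mem (smul_mem_vna M _ (mul_mem hsy hx)) (smul_mem_vna M _ (mul_mem hsy hy))),
      h.map_add _ (mul_mem hsx hx) _ (smul_mem_vna M _ (mul_mem hsx hy)),
      h.map_add _ (smul_mem_vna M _ (mul_mem hsy hx)) _ (smul_mem_vna M _ (mul_mem hsy hy)),
      h.map_smul _ _ (mul_mem hsx hy), h.map_smul _ _ (mul_mem hsy hx),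
      h.map_smul _ _ (mul_mem hsy hy)] at h1
    have h2 := im0 x hx
    have h3 := im0 y hy
    simp only [Complex.add_im, Complex.mul_im, Complex.mul_re, Complex.conj_re, Complex.conj_im]
      at h1 h2 h3 ⊢
    rw [h2, h3] at h1
    linarith
  have k1 := key 1
  have k2 := key Complex.I
  simp only [Complex.add_im, Complex.mul_im, Complex.conj_re, Complex.conj_im, Complex.one_re,
    Complex.one_im, Complex.I_re, Complex.I_im] at k1 k2
  apply Complex.ext <;> simp <;> linarith

theorem conj_star (h : IsPLF M ψ) {x : Op H} (hx : x ∈ M) :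
    ψ (star x) = starRingEnd ℂ (ψ x) := by
  have := h.conj_star_mul hx (one_mem M)
  simpa using this.symm

theorem gns_left (h : IsPLF M ψ) :
    ∃ (K : Type) (_ : NormedAddCommGroup K) (_ : InnerProductSpace ℂ K) (_ : CompleteSpace K)
      (j : M.toStarSubalgebra →ₗ[ℂ] K), DenseRange j ∧
        ∀ x y, inner ℂ (j x) (j y) = ψ (star (x : Op H) * y) := by
  apply exists_hilbert_of_form
  · rintro ⟨x, hx⟩ ⟨y, hy⟩ ⟨z, hz⟩
    simp only [AddMemClass.mk_add_mk, mul_add]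
    exact h.map_add _ (mul_mem (star_mem hx) hy) _ (mul_mem (star_mem hx) hz)
  · rintro c ⟨x, hx⟩ ⟨y, hy⟩
    simp only [SetLike.mk_smul_mk, mul_smul_comm]
    exact h.map_smul _ _ (mul_mem (star_mem hx) hy)
  · rintro ⟨x, hx⟩ ⟨y, hy⟩
    exact h.conj_star_mul hx hy
  · rintro ⟨x, hx⟩
    exact (Complex.le_def.1 (h.pos x hx)).1

theorem gns_right (h : IsPLF M ψ) :
    ∃ (K : Type) (_ : NormedAddCommGroup K) (_ : InnerProductSpace ℂ K) (_ : CompleteSpace K)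
      (j : M.toStarSubalgebra →ₗ[ℂ] K), DenseRange j ∧
        ∀ x y, inner ℂ (j x) (j y) = ψ ((y : Op H) * star (x : Op H)) := by
  apply exists_hilbert_of_form
  · rintro ⟨x, hx⟩ ⟨y, hy⟩ ⟨z, hz⟩
    simp only [AddMemClass.mk_add_mk, add_mul]
    exact h.map_add _ (mul_mem hy (star_mem hx)) _ (mul_mem hz (star_mem hx))
  · rintro c ⟨x, hx⟩ ⟨y, hy⟩
    simp only [SetLike.mk_smul_mk, smul_mul_assoc]
    exact h.map_smul _ _ (mul_mem hy (star_mem hx))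
  · rintro ⟨x, hx⟩ ⟨y, hy⟩
    have := h.conj_star_mul (star_mem hy) (star_mem hx)
    simpa using this
  · rintro ⟨x, hx⟩
    have := (Complex.le_def.1 (h.pos _ (star_mem hx))).1
    simpa using this

theorem re_nonneg (h : IsPLF M ψ) {x : Op H} (hx : x ∈ M) : 0 ≤ (ψ (star x * x)).re :=
  (Complex.le_def.1 (h.pos x hx)).1

theorem ofReal_re (h : IsPLF M ψ) {x : Op H} (hx : x ∈ M) :
    (((ψ (star x * x)).re : ℝ) : ℂ) = ψ (star x * x) := by
  have := (Complex.le_def.1 (h.pos x hx)).2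
  apply Complex.ext <;> simp_all

/-- The Cauchy-Schwarz inequality. -/
theorem cauchy_schwarz (h : IsPLF M ψ) {x y : Op H} (hx : x ∈ M) (hy : y ∈ M) :
    ‖ψ (star x * y)‖ ^ 2 ≤ (ψ (star x * x)).re * (ψ (star y * y)).re := by
  obtain ⟨K, _, _, _, j, -, hj⟩ := h.gns_left
  have h1 := norm_inner_le_norm (𝕜 := ℂ) (j ⟨x, hx⟩) (j ⟨y, hy⟩)
  have hn : ∀ z : M.toStarSubalgebra, ‖j z‖ ^ 2 = (ψ (star (z : Op H) * z)).re := by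
    intro z
    rw [← hj z z, inner_self_eq_norm_sq_to_K (𝕜 := ℂ)]
    norm_cast
  have h2 := hn ⟨x, hx⟩
  have h3 := hn ⟨y, hy⟩
  rw [hj] at h1
  simp only at h1 h2 h3
  rw [← h2, ← h3, ← mul_pow]
  exact pow_le_pow_left₀ (norm_nonneg _) h1 2

theorem eq_zero_of_right (h : IsPLF M ψ) {x y : Op H} (hx : x ∈ M) (hy : y ∈ M)
    (h0 : ψ (star y * y) = 0) : ψ (x * y) = 0 := by
  have := h.cauchy_schwarz (star_mem hx) hy
  rw [h0] at this
  simp at this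
  simpa using this

theorem eq_zero_of_left (h : IsPLF M ψ) {x y : Op H} (hx : x ∈ M) (hy : y ∈ M)
    (h0 : ψ (x * star x) = 0) : ψ (x * y) = 0 := by
  have := h.cauchy_schwarz (star_mem hx) hy
  simp [h0] at this
  simpa using this

end IsPLF

end PLF

/-! ### Positive operators in a von Neumann algebra -/

theorem isClosed_vna (M : VonNeumannAlgebra H) : IsClosed (M : Set (Op H)) := by
  rw [← M.centralizer_centralizer]
  exact Set.isClosed_centralizer _

theorem cfc_mem_vna (M : VonNeumannAlgebra H) {x : Op H} (hx : x ∈ M) (f : ℝ → ℝ) :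
    cfc f x ∈ M :=
  cfc_mem (S := StarSubalgebra ℂ (Op H)) (s := M.toStarSubalgebra) (𝕜' := ℂ)
    (hs := isClosed_vna M) f hx

theorem exists_star_mul_self (M : VonNeumannAlgebra H) {x : Op H} (hx : x ∈ M) (hp : 0 ≤ x) :
    ∃ y ∈ M, star y * y = x := by
  have hsa : IsSelfAdjoint x := hp.isSelfAdjoint
  refine ⟨cfc Real.sqrt x, cfc_mem_vna M hx _, ?_⟩
  rw [(cfc_predicate (R := ℝ) Real.sqrt x : IsSelfAdjoint _).star_eq,
    ← cfc_mul Real.sqrt Real.sqrt x]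
  conv_rhs => rw [← cfc_id ℝ x]
  exact cfc_congr fun t ht => Real.mul_self_sqrt (spectrum_nonneg_of_nonneg hp ht)

namespace IsPLF

variable {M : VonNeumannAlgebra H} {ψ : Op H → ℂ}

theorem nonneg (h : IsPLF M ψ) {x : Op H} (hx : x ∈ M) (hp : 0 ≤ x) : 0 ≤ ψ x := by
  obtain ⟨y, hy, rfl⟩ := exists_star_mul_self M hx hp
  exact h.pos y hy

theorem mono (h : IsPLF M ψ) {x y : Op H} (hx : x ∈ M) (hy : y ∈ M) (hxy : x ≤ y) :
    ψ x ≤ ψ y := by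
  have := h.nonneg (sub_mem hy hx) (sub_nonneg.2 hxy)
  rw [h.map_sub hy hx] at this
  exact sub_nonneg.1 this

theorem re_mono (h : IsPLF M ψ) {x y : Op H} (hx : x ∈ M) (hy : y ∈ M) (hxy : x ≤ y) :
    (ψ x).re ≤ (ψ y).re :=
  (Complex.le_def.1 (h.mono hx hy hxy)).1

theorem one_nonneg (h : IsPLF M ψ) : 0 ≤ (ψ 1).re := by
  simpa using h.re_nonneg (one_mem M)

theorem re_star_mul_le (h : IsPLF M ψ) {x : Op H} (hx : x ∈ M) :
    (ψ (star x * x)).re ≤ ‖x‖ ^ 2 * (ψ 1).re := by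
  have h1 : star x * x ≤ ((‖x‖ ^ 2 : ℝ) : ℂ) • (1 : Op H) := by
    have := IsSelfAdjoint.le_algebraMap_norm_self (IsSelfAdjoint.star_mul_self x)
    rw [CStarRing.norm_star_mul_self, Algebra.algebraMap_eq_smul_one] at this
    convert this using 1
    rw [pow_two, Complex.coe_smul]
  have := h.re_mono (mul_mem (star_mem hx) hx) (smul_mem_vna M _ (one_mem M)) h1
  rw [h.map_smul _ _ (one_mem M)] at this
  simpa only [Complex.re_ofReal_mul] using this

theorem norm_le (h : IsPLF M ψ) {x : Op H} (hx : x ∈ M) : ‖ψ x‖ ≤ (ψ 1).re * ‖x‖ := by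
  have h1 := h.cauchy_schwarz (one_mem M) hx
  simp only [star_one, one_mul] at h1
  have h2 := h.re_star_mul_le hx
  have h3 := h.one_nonneg
  refine le_of_sq_le_sq ?_ (by positivity)
  calc ‖ψ x‖ ^ 2 ≤ _ := h1
    _ ≤ (ψ 1).re * (‖x‖ ^ 2 * (ψ 1).re) := by gcongr
    _ = _ := by ring

end IsPLF

/-! ### Projections in a von Neumann algebra -/

theorem starProjection_mem (M : VonNeumannAlgebra H) (W : Submodule ℂ H)
    [W.HasOrthogonalProjection] (h : ∀ c ∈ M.commutant, ∀ w ∈ W, c w ∈ W) :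
    W.starProjection ∈ M := by
  rw [VonNeumannAlgebra.IsStarProjection.mem_iff (isStarProjection_starProjection)]
  intro c hc
  rw [Submodule.range_starProjection]
  exact fun w hw => h c hc w hw

theorem commutant_comm {M : VonNeumannAlgebra H} {c x : Op H} (hc : c ∈ M.commutant)
    (hx : x ∈ M) : x * c = c * x :=
  VonNeumannAlgebra.mem_commutant_iff.1 hc x hx

/-- The support projection of a self-adjoint operator. -/
noncomputable def suppProj (c : Op H) : Op H := 1 - (c.ker).starProjection

theorem suppProj_star (c : Op H) : star (suppProj c) = suppProj c := by
  have := (isStarProjection_starProjection (U := c.ker)).isSelfAdjoint.star_eq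
  simp [suppProj, this]

theorem suppProj_mul_self (c : Op H) : suppProj c * suppProj c = suppProj c := by
  have := (isStarProjection_starProjection (U := c.ker)).isIdempotentElem
  exact this.one_sub

theorem suppProj_mem (M : VonNeumannAlgebra H) {c : Op H} (hc : c ∈ M) : suppProj c ∈ M := by
  refine sub_mem (one_mem M) (starProjection_mem M _ fun d hd w hw => ?_)
  have h1 : c w = 0 := hw
  change c (d w) = 0
  have := congrArg (fun T : Op H => T w) (commutant_comm hd hc)
  simpa [h1] using this

theorem mul_suppProj (c : Op H) : c * suppProj c = c := by
  have : c * (c.ker).starProjection = 0 := by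
    ext ξ
    exact (c.ker).starProjection_apply_mem ξ
  rw [suppProj, mul_sub, this, mul_one, sub_zero]

theorem suppProj_mul {c : Op H} (hc : star c = c) : suppProj c * c = c := by
  have := congrArg star (mul_suppProj c)
  rwa [star_mul, suppProj_star, hc] at this

theorem suppProj_mul_eq_zero {c z : Op H} (h : c * z = 0) : suppProj c * z = 0 := by
  have : (c.ker).starProjection * z = z := by
    ext ξ
    refine Submodule.starProjection_eq_self_iff.2 ?_
    exact congrArg (fun T : Op H => T ξ) h
  rw [suppProj, sub_mul, this, one_mul, sub_self]

/-- The part of `2x - 1` above zero. -/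
noncomputable def upperPart (x : Op H) : Op H := cfc (fun t : ℝ => max (2 * t - 1) 0) x

/-- The part of `2x - 1` below zero. -/
noncomputable def lowerPart (x : Op H) : Op H := cfc (fun t : ℝ => max (1 - 2 * t) 0) x

section Halving

variable {x : Op H}

theorem spectrum_mem_unit (h0 : 0 ≤ x) (h1 : x ≤ 1) {t : ℝ} (ht : t ∈ spectrum ℝ x) :
    0 ≤ t ∧ t ≤ 1 := by
  refine ⟨spectrum_nonneg_of_nonneg h0 ht, ?_⟩
  have := (le_algebraMap_iff_spectrum_le (a := x) (r := (1 : ℝ))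
    (ha := h0.isSelfAdjoint)).1 (by simpa using h1)
  exact this t ht

theorem upperPart_nonneg : 0 ≤ upperPart x := cfc_nonneg fun _ _ => le_max_right _ _

theorem lowerPart_nonneg : 0 ≤ lowerPart x := cfc_nonneg fun _ _ => le_max_right _ _

theorem upperPart_le_one (h0 : 0 ≤ x) (h1 : x ≤ 1) : upperPart x ≤ 1 :=
  cfc_le_one _ _ fun t ht => by
    have := spectrum_mem_unit h0 h1 ht
    exact max_le (by linarith) zero_le_one

theorem lowerPart_le_one (h0 : 0 ≤ x) (h1 : x ≤ 1) : lowerPart x ≤ 1 :=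
  cfc_le_one _ _ fun t ht => by
    have := spectrum_mem_unit h0 h1 ht
    exact max_le (by linarith) zero_le_one

theorem upperPart_mul_lowerPart : upperPart x * lowerPart x = 0 := by
  rw [upperPart, lowerPart, ← cfc_mul _ _ x]
  rw [← cfc_zero ℝ x]
  refine cfc_congr fun t _ => ?_
  rcases le_total (2 * t - 1) 0 with h | h
  · simp [max_eq_right h]
  · simp [max_eq_right (show 1 - 2 * t ≤ 0 by linarith)]

theorem upperPart_sub_lowerPart (h0 : 0 ≤ x) : upperPart x - lowerPart x = x + x - 1 := by
  have hsa : IsSelfAdjoint x := h0.isSelfAdjoint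
  have e : x + x - 1 = cfc (fun t : ℝ => t + t - 1) x := by
    rw [cfc_sub .., cfc_add .., cfc_id' ℝ x, cfc_const_one ℝ x]
  rw [e, upperPart, lowerPart, ← cfc_sub ..]
  refine cfc_congr fun t _ => ?_
  rcases le_total (2 * t - 1) 0 with h | h
  · rw [max_eq_right h, max_eq_left (show 0 ≤ 1 - 2 * t by linarith)]; ring
  · rw [max_eq_left h, max_eq_right (show 1 - 2 * t ≤ 0 by linarith)]; ring

theorem suppProj_upperPart_mul : suppProj (upperPart x) * upperPart x = upperPart x :=
  suppProj_mul (upperPart_nonneg (x := x)).isSelfAdjoint.star_eq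

theorem suppProj_mul_lowerPart : suppProj (upperPart x) * lowerPart x = 0 :=
  suppProj_mul_eq_zero upperPart_mul_lowerPart

theorem lowerPart_mul_suppProj : lowerPart x * suppProj (upperPart x) = 0 := by
  have := congrArg star (suppProj_mul_lowerPart (x := x))
  rwa [star_mul, suppProj_star, (lowerPart_nonneg (x := x)).isSelfAdjoint.star_eq, star_zero]
    at this

theorem conj_nonneg_of_star_eq {p a : Op H} (hp : star p = p) (ha : 0 ≤ a) : 0 ≤ p * a * p := by
  have := star_left_conjugate_nonneg ha p
  rwa [hp] at this

/-- Twice an operator of the unit interval is a projection plus an operator of the unit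
interval. -/
theorem suppProj_le_add_self (h0 : 0 ≤ x) (h1 : x ≤ 1) : suppProj (upperPart x) ≤ x + x := by
  set p := suppProj (upperPart x)
  have hs : star (1 - p) = 1 - p := by rw [star_sub, star_one, suppProj_star]
  have h := conj_nonneg_of_star_eq hs (sub_nonneg.2 (lowerPart_le_one h0 h1))
  have e : (1 - p) * (1 - lowerPart x) * (1 - p) + upperPart x = x + x - p := by
    have e1 := upperPart_sub_lowerPart h0
    have e2 : p * p = p := suppProj_mul_self _
    have e3 : p * lowerPart x = 0 := suppProj_mul_lowerPart
    have e4 : lowerPart x * p = 0 := lowerPart_mul_suppProj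
    have e5 : x + x = upperPart x - lowerPart x + 1 := by rw [e1]; abel
    rw [e5]
    simp only [sub_mul, mul_sub, one_mul, mul_one, e2, e3, e4, zero_mul]
    abel
  rw [← sub_nonneg, ← e]
  exact add_nonneg h upperPart_nonneg

theorem add_self_sub_suppProj_le_one (h0 : 0 ≤ x) (h1 : x ≤ 1) :
    x + x - suppProj (upperPart x) ≤ 1 := by
  set p := suppProj (upperPart x)
  have h := conj_nonneg_of_star_eq (suppProj_star (upperPart x))
    (sub_nonneg.2 (upperPart_le_one h0 h1))
  have e : p * (1 - upperPart x) * p + lowerPart x = 1 - (x + x - p) := by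
    have e1 := upperPart_sub_lowerPart h0
    have e2 : p * p = p := suppProj_mul_self _
    have e3 : p * upperPart x = upperPart x := suppProj_upperPart_mul
    have e4 : upperPart x * p = upperPart x := mul_suppProj _
    have e5 : x + x = upperPart x - lowerPart x + 1 := by rw [e1]; abel
    rw [e5]
    simp only [sub_mul, mul_sub, mul_one, e2, e3, e4]
    abel
  rw [← sub_nonneg, ← e]
  exact add_nonneg h lowerPart_nonneg

theorem mul_eq_zero_of_le {p y f : Op H} (hs : star p = p) (hi : p * p = p) (hle : p ≤ y)
    (hy : y * f = 0) : p * f = 0 := by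
  have h := star_left_conjugate_le_conjugate hle f
  rw [mul_assoc (star f) y, hy, mul_zero] at h
  have e : star f * p * f = star (p * f) * (p * f) := by
    rw [star_mul, hs, mul_assoc, mul_assoc, ← mul_assoc p p f, hi]
  have h2 := le_antisymm h (by rw [e]; exact star_mul_self_nonneg _)
  rw [e] at h2
  exact (CStarRing.star_mul_self_eq_zero_iff _).1 h2

end Halving

theorem inner_apply_of_star_eq {r : Op H} (h : star r = r) (ξ η : H) :
    inner ℂ (r ξ) η = inner ℂ ξ (r η) := by
  rw [← ContinuousLinearMap.adjoint_inner_right, ← ContinuousLinearMap.star_eq_adjoint, h]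

theorem inner_star_left (r : Op H) (ξ η : H) :
    inner ℂ (star r ξ) η = inner ℂ ξ (r η) := by
  rw [ContinuousLinearMap.star_eq_adjoint, ContinuousLinearMap.adjoint_inner_left]

theorem inner_star_right (r : Op H) (ξ η : H) :
    inner ℂ ξ (star r η) = inner ℂ (r ξ) η := by
  rw [ContinuousLinearMap.star_eq_adjoint, ContinuousLinearMap.adjoint_inner_right]

/-- An orthogonal family of projections is strongly summable to a projection. -/
theorem exists_hasSum_proj (M : VonNeumannAlgebra H) {ι : Type} (f : ι → Op H)
    (hf : ∀ i, IsProjIn (M : Set (Op H)) (f i)) (ho : Pairwise fun i j => f i * f j = 0) :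
    ∃ q, IsProjIn (M : Set (Op H)) q ∧ ∀ ξ, HasSum (fun i => f i ξ) (q ξ) := by
  have hmem : ∀ i, f i ∈ M := fun i => (hf i).1
  let W : Submodule ℂ H := (⨆ i, (f i).range).topologicalClosure
  have hW : ∀ i ξ, f i ξ ∈ W := fun i ξ =>
    Submodule.le_topologicalClosure _ (le_iSup (fun i => (f i).range) i ⟨ξ, rfl⟩)
  have hidem : ∀ i ξ, f i (f i ξ) = f i ξ := fun i ξ =>
    congrArg (fun T : Op H => T ξ) (hf i).2.2
  have hoff : ∀ i j, i ≠ j → ∀ ξ, f i (f j ξ) = 0 := fun i j hij ξ =>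
    congrArg (fun T : Op H => T ξ) (ho hij)
  have hof : OrthogonalFamily ℂ (fun i => (f i).range) (fun i => ((f i).range).subtypeₗᵢ) := by
    rintro i j hij ⟨_, x, rfl⟩ ⟨_, y, rfl⟩
    change inner ℂ (f i x) (f j y) = 0
    rw [inner_apply_of_star_eq (hf i).2.1, hoff i j hij, inner_zero_right]
  have hsumm : ∀ ξ, Summable (fun i => f i ξ) := by
    intro ξ
    have := (hof.summable_iff_norm_sq_summable (fun i => ⟨f i ξ, ξ, rfl⟩)).2 ?_
    · exact this
    refine summable_of_sum_le (c := ‖ξ‖ ^ 2) (fun _ => by positivity) fun s => ?_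
    have h1 := hof.norm_sum (fun i => ⟨f i ξ, ξ, rfl⟩) s
    have h2 : (‖∑ i ∈ s, f i ξ‖ : ℝ) ^ 2 ≤ ‖∑ i ∈ s, f i ξ‖ * ‖ξ‖ := by
      have h3 : ∑ i ∈ s, ‖f i ξ‖ ^ 2 = RCLike.re (inner ℂ (∑ i ∈ s, f i ξ) ξ) := by
        rw [sum_inner, _root_.map_sum]
        refine Finset.sum_congr rfl fun i _ => ?_
        rw [← hidem i ξ, inner_apply_of_star_eq (hf i).2.1, hidem, inner_self_eq_norm_sq]
      have h4 : ‖∑ i ∈ s, f i ξ‖ ^ 2 = ∑ i ∈ s, ‖f i ξ‖ ^ 2 := h1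
      rw [h4, h3]
      exact (RCLike.re_le_norm _).trans (norm_inner_le_norm _ _)
    have h5 : ‖∑ i ∈ s, f i ξ‖ ≤ ‖ξ‖ := by
      by_contra hc
      nlinarith [norm_nonneg ξ]
    calc ∑ i ∈ s, ‖(⟨f i ξ, ξ, rfl⟩ : (f i).range)‖ ^ 2 = ‖∑ i ∈ s, f i ξ‖ ^ 2 := h1.symm
      _ ≤ ‖ξ‖ ^ 2 := by gcongr
  refine ⟨W.starProjection, ⟨starProjection_mem M W fun c hc => ?_,
    isStarProjection_starProjection.isSelfAdjoint.star_eq,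
    isStarProjection_starProjection.isIdempotentElem⟩, fun ξ => ?_⟩
  · have h1 : ∀ w ∈ (⨆ i, (f i).range : Submodule ℂ H), c w ∈ (⨆ i, (f i).range : Submodule ℂ H) := by
      change (⨆ i, (f i).range : Submodule ℂ H) ≤ (⨆ i, (f i).range : Submodule ℂ H).comap c.toLinearMap
      refine iSup_le fun i => ?_
      rintro _ ⟨x, rfl⟩
      refine le_iSup (fun i => (f i).range) i ⟨c x, ?_⟩
      exact congrArg (fun T : Op H => T x) (commutant_comm hc (hmem i))
    exact fun w hw => map_mem_closure c.continuous hw h1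
  · have hs := (hsumm ξ).hasSum
    suffices h : W.starProjection ξ = ∑' i, f i ξ by rwa [h]
    refine Submodule.eq_starProjection_of_mem_orthogonal ?_ ?_
    · exact (Submodule.isClosed_topologicalClosure _).mem_of_tendsto hs
        (Filter.Eventually.of_forall fun s => sum_mem fun i _ => hW i ξ)
    · rw [Submodule.orthogonal_closure, Submodule.mem_orthogonal]
      have key : ∀ i, f i (ξ - ∑' i, f i ξ) = 0 := by
        intro i
        have h1 := (hs.mapL (f i))
        have h2 : HasSum (fun j => f i (f j ξ)) (f i ξ) := by
          have := hasSum_single (f := fun j => f i (f j ξ)) i fun j hj => hoff i j hj.symm ξ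
          simpa only [hidem] using this
        rw [map_sub, h1.unique h2, sub_self]
      intro u hu
      induction hu using Submodule.iSup_induction' with
      | mem i x hx =>
        obtain ⟨y, rfl⟩ := hx
        change inner ℂ (f i y) _ = 0
        rw [inner_apply_of_star_eq (hf i).2.1, key, inner_zero_right]
      | zero => exact inner_zero_left _
      | add x y _ _ hx hy => rw [inner_add_left, hx, hy, add_zero]

/-- Every property of projections admits a maximal orthogonal family below a given projection. -/
theorem exists_exhaustion (M : VonNeumannAlgebra H) (e : Op H)
    (Pr : Op H → Prop) :
    ∃ (ι : Type) (f : ι → Op H) (q : Op H), (∀ i, IsProjIn (M : Set (Op H)) (f i)) ∧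
      (∀ i, Pr (f i)) ∧ (Pairwise fun i j => f i * f j = 0) ∧
      IsProjIn (M : Set (Op H)) q ∧ (∀ ξ, HasSum (fun i => f i ξ) (q ξ)) ∧ e * q = q ∧
      ∀ r, IsProjIn (M : Set (Op H)) r → e * r = r → r * q = 0 → Pr r → r = 0 := by
  let good : Op H → Prop := fun r => IsProjIn (M : Set (Op H)) r ∧ e * r = r ∧ Pr r ∧ r ≠ 0
  obtain ⟨S, hS⟩ := zorn_subset
    {S : Set (Op H) | (∀ r ∈ S, good r) ∧ S.Pairwise fun r s => r * s = 0} (by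
      intro c hc hchain
      refine ⟨⋃₀ c, ⟨?_, ?_⟩, fun s hs => Set.subset_sUnion_of_mem hs⟩
      · rintro r ⟨s, hs, hr⟩
        exact (hc hs).1 r hr
      · exact (Set.pairwise_sUnion hchain.directedOn).2 fun s hs => (hc hs).2)
  obtain ⟨hS1, hS2⟩ := hS.prop
  have ho : Pairwise fun i j : S => (i : Op H) * (j : Op H) = 0 :=
    fun i j hij => hS2 i.2 j.2 fun h => hij (Subtype.ext h)
  obtain ⟨q, hq, hsum⟩ := exists_hasSum_proj M (fun i : S => (i : Op H)) (fun i => (hS1 i i.2).1) ho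
  refine ⟨S, fun i => i, q, fun i => (hS1 i i.2).1, fun i => (hS1 i i.2).2.2.1, ho, hq, hsum, ?_,
    fun r hr hre hrq hPr => ?_⟩
  · ext ξ
    refine ((hsum ξ).mapL e).unique ?_
    have : ∀ i : S, e ((i : Op H) ξ) = (i : Op H) ξ := fun i =>
      congrArg (fun T : Op H => T ξ) (hS1 i i.2).2.1
    simpa only [this] using hsum ξ
  · by_contra h0
    have hqi : ∀ s ∈ S, r * s = 0 := by
      intro s hs
      have h1 : s * q = s := by
        ext ξ
        refine ((hsum ξ).mapL s).unique ?_
        have := hasSum_single (f := fun j : S => s ((j : Op H) ξ)) ⟨s, hs⟩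
          fun j hj => congrArg (fun T : Op H => T ξ) (ho hj.symm)
        convert this using 1
        exact (congrArg (fun T : Op H => T ξ) (hS1 s hs).1.2.2).symm
      have h2 := congrArg star h1
      rw [star_mul, (hS1 s hs).1.2.1, hq.2.1] at h2
      rw [← h2, ← mul_assoc, hrq, zero_mul]
    have hmem : r ∈ S := by
      refine hS.mem_of_prop_insert ⟨?_, ?_⟩
      · rintro s (rfl | hs)
        · exact ⟨hr, hre, hPr, h0⟩
        · exact hS1 s hs
      · refine hS2.insert fun s hs _ => ⟨hqi s hs, ?_⟩
        have := congrArg star (hqi s hs)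
        rwa [star_mul, (hS1 s hs).1.2.1, hr.2.1, star_zero] at this
    exact h0 (by rw [← hr.2.2]; exact hqi r hmem)

theorem isPLF_vector (M : VonNeumannAlgebra H) (ξ : H) :
    IsPLF M (fun x => inner ℂ ξ (x ξ)) where
  map_add := fun x _ y _ => by simp
  map_smul := fun c x _ => by simp
  pos := fun x _ => by
    change 0 ≤ inner ℂ ξ (star x (x ξ))
    rw [inner_star_right, inner_self_eq_norm_sq_to_K]
    positivity

theorem inner_star_mul_self (x : Op H) (ξ : H) :
    inner ℂ ξ ((star x * x) ξ) = ((‖x ξ‖ ^ 2 : ℝ) : ℂ) := by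
  change inner ℂ ξ (star x (x ξ)) = _
  rw [inner_star_right, inner_self_eq_norm_sq_to_K]
  norm_cast

/-- A domination on projections extends to the whole corner. -/
theorem IsPLF.le_of_forall_proj {M : VonNeumannAlgebra H} {ψ ω : Op H → ℂ} (hψ : IsPLF M ψ)
    (hω : IsPLF M ω) {f : Op H} (hf : IsProjIn (M : Set (Op H)) f)
    (h : ∀ r, IsProjIn (M : Set (Op H)) r → f * r = r → (ψ r).re ≤ (ω r).re)
    {x : Op H} (hx : x ∈ M) (h0 : 0 ≤ x) (h1 : x ≤ 1) (hfx : f * x = x) :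
    (ψ x).re ≤ (ω x).re := by
  have key : ∀ n : ℕ, ∀ x ∈ M, 0 ≤ x → x ≤ 1 → f * x = x →
      (ψ x).re ≤ (ω x).re + (ψ 1).re / 2 ^ n := by
    intro n
    induction n with
    | zero =>
      intro x hx h0 h1 _
      have a := hψ.re_mono hx (one_mem M) h1
      have b := (Complex.le_def.1 (hω.nonneg hx h0)).1
      simp only [Complex.zero_re] at b
      simp only [pow_zero, div_one]
      linarith
    | succ n ih =>
      intro x hx h0 h1 hfx
      have hp1 : suppProj (upperPart x) ∈ M := suppProj_mem M (cfc_mem_vna M hx _)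
      have hp := suppProj_le_add_self h0 h1
      have hp' := add_self_sub_suppProj_le_one h0 h1
      set p := suppProj (upperPart x)
      have hps : star p = p := suppProj_star _
      have hpp : p * p = p := suppProj_mul_self _
      have hfp : f * p = p := by
        have e1 : (x + x) * (1 - f) = 0 := by
          have := congrArg star hfx
          rw [star_mul, hf.2.1, h0.isSelfAdjoint.star_eq] at this
          rw [mul_sub, mul_one, add_mul, this, sub_self]
        have e2 := congrArg star (mul_eq_zero_of_le hps hpp hp e1)
        rw [star_mul, hps, star_sub, star_one, hf.2.1, star_zero, sub_mul, one_mul] at e2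
        exact (sub_eq_zero.1 e2).symm
      have hxx := add_mem hx hx
      have i1 := ih (x + x - p) (sub_mem hxx hp1) (sub_nonneg.2 hp) hp'
        (by rw [mul_sub, mul_add, hfx, hfp])
      have i2 := h p ⟨hp1, hps, hpp⟩ hfp
      rw [hψ.map_sub hxx hp1, hω.map_sub hxx hp1, hψ.map_add _ hx _ hx, hω.map_add _ hx _ hx] at i1
      simp only [Complex.sub_re, Complex.add_re] at i1
      rw [pow_succ, ← div_div]
      linarith
  have lim : Filter.Tendsto (fun n : ℕ => (ω x).re + (ψ 1).re / 2 ^ n) Filter.atTop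
      (nhds ((ω x).re + 0)) :=
    tendsto_const_nhds.add (tendsto_const_nhds.div_atTop
      (tendsto_pow_atTop_atTop_of_one_lt (by norm_num)))
  rw [add_zero] at lim
  exact ge_of_tendsto' lim fun n => key n x hx h0 h1 hfx

theorem IsPLF.star_mul_le_of_forall_proj {M : VonNeumannAlgebra H} {ψ ω : Op H → ℂ}
    (hψ : IsPLF M ψ) (hω : IsPLF M ω) {f : Op H} (hf : IsProjIn (M : Set (Op H)) f)
    (h : ∀ r, IsProjIn (M : Set (Op H)) r → f * r = r → (ψ r).re ≤ (ω r).re)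
    {x : Op H} (hx : x ∈ M) (hxf : x * f = x) :
    (ψ (star x * x)).re ≤ (ω (star x * x)).re := by
  rcases eq_or_ne x 0 with rfl | hx0
  · simp [hψ.map_zero, hω.map_zero]
  have hn : ‖x‖ ≠ 0 := norm_ne_zero_iff.2 hx0
  have hmem := mul_mem (star_mem hx) hx
  set c : ℝ := (‖x‖ ^ 2)⁻¹
  have hc : 0 < c := by positivity
  have hle : star x * x ≤ (‖x‖ ^ 2) • (1 : Op H) := by
    have := IsSelfAdjoint.le_algebraMap_norm_self (IsSelfAdjoint.star_mul_self x)
    rwa [CStarRing.norm_star_mul_self, Algebra.algebraMap_eq_smul_one, ← pow_two] at this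
  have h1 : c • (star x * x) ≤ 1 := by
    have := smul_le_smul_of_nonneg_left hle hc.le
    rwa [smul_smul, inv_mul_cancel₀ (by positivity), one_smul] at this
  have hfx : f * star x = star x := by
    have := congrArg star hxf
    rwa [star_mul, hf.2.1] at this
  have hcm : c • (star x * x) ∈ M := by
    rw [← Complex.coe_smul]; exact smul_mem_vna M _ hmem
  have key := hψ.le_of_forall_proj hω hf h hcm (smul_nonneg hc.le (star_mul_self_nonneg x)) h1
    (by rw [mul_smul_comm, ← mul_assoc, hfx])
  rw [← Complex.coe_smul, hψ.map_smul _ _ hmem, hω.map_smul _ _ hmem, Complex.re_ofReal_mul,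
    Complex.re_ofReal_mul] at key
  exact le_of_mul_le_mul_left key hc

/-- Riesz representation of a functional bounded along a linear map. -/
theorem exists_riesz {V K : Type} [AddCommGroup V] [Module ℂ V] [NormedAddCommGroup K]
    [InnerProductSpace ℂ K] [CompleteSpace K] (T : V →ₗ[ℂ] K) (g : V →ₗ[ℂ] ℂ) (C : ℝ)
    (h : ∀ v, ‖g v‖ ≤ C * ‖T v‖) :
    ∃ η ∈ closure (Set.range T), ∀ v, g v = inner ℂ η (T v) := by
  let W := T.range.topologicalClosure
  let T' : V →ₗ[ℂ] W := T.codRestrict W fun v => Submodule.le_topologicalClosure _ ⟨v, rfl⟩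
  have hd : DenseRange T' := by
    intro w
    rw [closure_subtype]
    have h1 : (w : K) ∈ closure (T.range : Set K) := w.2
    convert h1 using 2
    ext y
    constructor
    · rintro ⟨_, ⟨v, rfl⟩, rfl⟩
      exact ⟨v, rfl⟩
    · rintro ⟨v, rfl⟩
      exact ⟨T' v, ⟨v, rfl⟩, rfl⟩
  have hex := LinearMap.extendOfNorm_eq (f := g) hd ⟨C, h⟩
  refine ⟨((InnerProductSpace.toDual ℂ W).symm (g.extendOfNorm T') : W), ?_, fun v => ?_⟩
  · exact ((InnerProductSpace.toDual ℂ W).symm (g.extendOfNorm T')).2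
  · rw [← hex v]
    exact (InnerProductSpace.toDual_symm_apply (x := T' v)).symm

/-- A nonzero normal functional dominates a nonzero vector functional. -/
theorem IsNormalPLF.exists_vector_le {M : VonNeumannAlgebra H} {ψ : Op H → ℂ}
    (hψ : IsNormalPLF M ψ) (h1 : ψ 1 ≠ 0) :
    ∃ η : H, η ≠ 0 ∧ ∀ y ∈ M, ‖y η‖ ^ 2 ≤ (ψ (star y * y)).re := by
  have hP := hψ.toIsPLF
  have one_sub_proj : ∀ {r}, IsProjIn (M : Set (Op H)) r → IsProjIn (M : Set (Op H)) (1 - r) :=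
    fun {r} hr => ⟨sub_mem (one_mem M) hr.1, by rw [star_sub, star_one, hr.2.1],
      by simp [mul_sub, sub_mul, hr.2.2]⟩
  obtain ⟨ι, n, n0, hn, hnP, hno, hn0, hns, -, hnm⟩ := exists_exhaustion M 1 (fun r => ψ r = 0)
  have hψn0 : ψ n0 = 0 := by
    have := hψ.normal ι n n0 hn hn0 hno hns
    simp only [hnP] at this
    exact this.unique hasSum_zero
  set e := 1 - n0
  have he : IsProjIn (M : Set (Op H)) e := one_sub_proj hn0
  have hfaith : ∀ r, IsProjIn (M : Set (Op H)) r → e * r = r → ψ r = 0 → r = 0 := by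
    intro r hr her hr0
    refine hnm r hr (one_mul r) ?_ hr0
    have : star (e * r) * n0 = r * n0 := by rw [her, hr.2.1]
    rw [← this, star_mul, he.2.1, mul_assoc, sub_mul, one_mul, hn0.2.2, sub_self, mul_zero]
  have hψe : ψ e = ψ 1 := by rw [hP.map_sub (one_mem M) hn0.1, hψn0, sub_zero]
  have he0 : e ≠ 0 := fun h => h1 (by rw [← hψe, h, hP.map_zero])
  obtain ⟨ξ, hξe, hξ⟩ : ∃ ξ : H, e ξ = ξ ∧ (ψ 1).re < ‖ξ‖ ^ 2 := by
    obtain ⟨ζ, hζ⟩ : ∃ ζ, e ζ ≠ 0 := by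
      by_contra! h
      exact he0 (ContinuousLinearMap.ext h)
    have hpos := norm_pos_iff.2 hζ
    have hb := hP.one_nonneg
    refine ⟨((((ψ 1).re + 1) / ‖e ζ‖ : ℝ) : ℂ) • e ζ, ?_, ?_⟩
    · rw [map_smul]
      congr 1
      exact congrArg (fun T : Op H => T ζ) he.2.2
    · rw [norm_smul, Complex.norm_real, Real.norm_of_nonneg (by positivity),
        div_mul_cancel₀ _ hpos.ne']
      nlinarith
  let ω : Op H → ℂ := fun x => inner ℂ ξ (x ξ)
  have hω : IsPLF M ω := isPLF_vector M ξ
  obtain ⟨κ, f, f0, hf, hfP, hfo, hf0, hfs, hef0, hfm⟩ :=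
    exists_exhaustion M e (fun r => (ω r).re ≤ (ψ r).re)
  set d := e - f0
  have hf0e : f0 * e = f0 := by
    have := congrArg star hef0
    rwa [star_mul, he.2.1, hf0.2.1] at this
  have hd : IsProjIn (M : Set (Op H)) d := by
    refine ⟨sub_mem he.1 hf0.1, by rw [star_sub, he.2.1, hf0.2.1], ?_⟩
    simp only [d, mul_sub, sub_mul, he.2.2, hf0.2.2, hef0, hf0e]
    abel
  have hdf0 : d * f0 = 0 := by rw [sub_mul, hef0, hf0.2.2, sub_self]
  have hed : e * d = d := by rw [mul_sub, he.2.2, hef0]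
  have hωf0 : (ω f0).re ≤ (ψ f0).re := by
    have a := (Complex.reCLM.hasSum (hψ.normal κ f f0 hf hf0 hfo hfs))
    have b := (Complex.reCLM.hasSum ((hfs ξ).mapL (innerSL ℂ ξ)))
    exact hasSum_le hfP b a
  have hd0 : d ≠ 0 := by
    intro h
    have hef : e = f0 := sub_eq_zero.1 h
    rw [← hef, hψe] at hωf0
    have : ω e = ((‖ξ‖ ^ 2 : ℝ) : ℂ) := by
      change inner ℂ ξ (e ξ) = _
      rw [hξe, inner_self_eq_norm_sq_to_K]
      norm_cast
    rw [this, Complex.ofReal_re] at hωf0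
    linarith
  have hψd : ψ d ≠ 0 := fun h => hd0 (hfaith d hd hed h)
  have hdom : ∀ r, IsProjIn (M : Set (Op H)) r → d * r = r → (ψ r).re ≤ (ω r).re := by
    intro r hr hdr
    by_contra! hlt
    have her : e * r = r := by rw [← hdr, ← mul_assoc, hed]
    have hrf : r * f0 = 0 := by
      have : star (d * r) * f0 = r * f0 := by rw [hdr, hr.2.1]
      rw [← this, star_mul, hd.2.1, mul_assoc, hdf0, mul_zero]
    have := hfm r hr her hrf hlt.le
    rw [this, hP.map_zero, hω.map_zero] at hlt
    exact lt_irrefl _ hlt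
  have hdomx : ∀ x ∈ M, (ψ (star (x * d) * (x * d))).re ≤ ‖(x * d) ξ‖ ^ 2 := by
    intro x hx
    have := hP.star_mul_le_of_forall_proj hω hd hdom (mul_mem hx hd.1)
      (by rw [mul_assoc, hd.2.2])
    rwa [show ω (star (x * d) * (x * d)) = _ from inner_star_mul_self (x * d) ξ,
      Complex.ofReal_re] at this
  let T : M.toStarSubalgebra →ₗ[ℂ] H :=
    { toFun := fun x => ((x : Op H) * d) ξ
      map_add' := fun x y => by simp [add_mul]
      map_smul' := fun c x => by simp }
  let g : M.toStarSubalgebra →ₗ[ℂ] ℂ :=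
    { toFun := fun x => ψ ((x : Op H) * d)
      map_add' := fun x y => by
        simp only [AddMemClass.coe_add, add_mul]
        exact hP.map_add _ (mul_mem x.2 hd.1) _ (mul_mem y.2 hd.1)
      map_smul' := fun c x => by
        simp only [SetLike.val_smul, smul_mul_assoc, RingHom.id_apply, smul_eq_mul]
        exact hP.map_smul _ _ (mul_mem x.2 hd.1) }
  have hbound : ∀ y ∈ M, ∀ x ∈ M,
      ‖ψ (star y * (x * d))‖ ≤ Real.sqrt (ψ (star y * y)).re * ‖(x * d) ξ‖ := by
    intro y hy x hx
    have a := hP.cauchy_schwarz hy (mul_mem hx hd.1)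
    refine le_of_sq_le_sq ?_ (by positivity)
    rw [mul_pow, Real.sq_sqrt (hP.re_nonneg hy)]
    exact a.trans (mul_le_mul_of_nonneg_left (hdomx x hx) (hP.re_nonneg hy))
  obtain ⟨η, hη, hgη⟩ := exists_riesz T g (Real.sqrt (ψ (star 1 * 1)).re) fun x => by
    have := hbound 1 (one_mem M) x x.2
    rwa [star_one, one_mul] at this ⊢
  have hgη' : ∀ x ∈ M, ψ (x * d) = inner ℂ η ((x * d) ξ) := fun x hx => hgη ⟨x, hx⟩
  refine ⟨η, ?_, fun y hy => ?_⟩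
  · rintro rfl
    have := hgη' 1 (one_mem M)
    rw [one_mul, inner_zero_left] at this
    exact hψd this
  · have hyη : y η ∈ closure (Set.range T) := by
      refine map_mem_closure y.continuous hη ?_
      rintro _ ⟨x, rfl⟩
      exact ⟨⟨y, hy⟩ * x, rfl⟩
    have h2 : ∀ ζ ∈ closure (Set.range T),
        ‖(inner ℂ (y η) ζ : ℂ)‖ ≤ Real.sqrt (ψ (star y * y)).re * ‖ζ‖ := by
      intro ζ hζ
      refine closure_minimal (s := Set.range T) (t := {ζ | ‖(inner ℂ (y η) ζ : ℂ)‖ ≤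
        Real.sqrt (ψ (star y * y)).re * ‖ζ‖}) ?_ (isClosed_le (by fun_prop) (by fun_prop)) hζ
      rintro _ ⟨x, rfl⟩
      have a := hbound y hy x x.2
      rw [← mul_assoc, hgη' _ (mul_mem (star_mem hy) x.2), mul_assoc] at a
      change ‖(inner ℂ (y η) (((x : Op H) * d) ξ) : ℂ)‖ ≤ _
      rw [← inner_star_right]
      exact a
    have h3 := h2 _ hyη
    rw [inner_self_eq_norm_sq_to_K, norm_pow, RCLike.norm_ofReal, abs_norm] at h3
    have h4 : ‖y η‖ ≤ Real.sqrt (ψ (star y * y)).re := by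
      by_contra! hc
      nlinarith [norm_nonneg (y η), Real.sqrt_nonneg (ψ (star y * y)).re]
    calc ‖y η‖ ^ 2 ≤ Real.sqrt (ψ (star y * y)).re ^ 2 := by gcongr
      _ = _ := Real.sq_sqrt (hP.re_nonneg hy)

theorem summable_inner_apply {ι : Type} {ζ : ι → H} (h : Summable fun i => ‖ζ i‖ ^ 2) (x : Op H) :
    Summable fun i => (inner ℂ (ζ i) (x (ζ i)) : ℂ) := by
  refine Summable.of_norm_bounded (h.mul_left ‖x‖) fun i => ?_
  calc ‖(inner ℂ (ζ i) (x (ζ i)) : ℂ)‖ ≤ ‖ζ i‖ * ‖x (ζ i)‖ := norm_inner_le_norm _ _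
    _ ≤ ‖ζ i‖ * (‖x‖ * ‖ζ i‖) := by gcongr; exact x.le_opNorm _
    _ = ‖x‖ * ‖ζ i‖ ^ 2 := by ring

/-- Square summable families of vectors give completely additive functionals. -/
theorem hasSum_tsum_inner {ι : Type} {ζ : ι → H} (h : Summable fun i => ‖ζ i‖ ^ 2)
    {M : VonNeumannAlgebra H} {κ : Type} {p : κ → Op H} {q : Op H}
    (hp : ∀ i, IsProjIn (M : Set (Op H)) (p i)) (hs : ∀ ξ, HasSum (fun i => p i ξ) (q ξ)) :
    HasSum (fun k => ∑' i, (inner ℂ (ζ i) (p k (ζ i)) : ℂ)) (∑' i, inner ℂ (ζ i) (q (ζ i))) := by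
  have hF : ∀ i k, (inner ℂ (ζ i) (p k (ζ i)) : ℂ) = ((‖p k (ζ i)‖ ^ 2 : ℝ) : ℂ) := by
    intro i k
    have := inner_star_mul_self (p k) (ζ i)
    rwa [(hp k).2.1, (hp k).2.2] at this
  have hrow : ∀ i, HasSum (fun k => (inner ℂ (ζ i) (p k (ζ i)) : ℂ)) (inner ℂ (ζ i) (q (ζ i))) :=
    fun i => (hs (ζ i)).mapL (innerSL ℂ (ζ i))
  have hrow' : ∀ i, HasSum (fun k => ‖p k (ζ i)‖ ^ 2) (inner ℂ (ζ i) (q (ζ i)) : ℂ).re := by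
    intro i
    have := Complex.reCLM.hasSum (hrow i)
    simpa only [hF, Function.comp_def, Complex.reCLM_apply, Complex.ofReal_re] using this
  have hsum : Summable fun x : ι × κ => (inner ℂ (ζ x.1) (p x.2 (ζ x.1)) : ℂ) := by
    simp only [hF]
    refine Complex.summable_ofReal.2 ((summable_prod_of_nonneg fun _ => by positivity).2
      ⟨fun i => (hrow' i).summable, ?_⟩)
    simp only [(hrow' _).tsum_eq]
    exact (Complex.reCLM.hasSum (summable_inner_apply h q).hasSum).summable
  have h1 := hsum.hasSum.prod_fiberwise hrow
  rw [h1.tsum_eq]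
  have h2 : HasSum (fun x : κ × ι => (inner ℂ (ζ x.2) (p x.1 (ζ x.2)) : ℂ)) _ :=
    (Equiv.prodComm κ ι).hasSum_iff.2 hsum.hasSum
  exact h2.prod_fiberwise fun k => (summable_inner_apply h (p k)).hasSum

/-- Normal positive functionals are sums of vector functionals. -/
theorem IsNormalPLF.exists_hasSum {M : VonNeumannAlgebra H} {ψ : Op H → ℂ}
    (hψ : IsNormalPLF M ψ) :
    ∃ (ι : Type) (ζ : ι → H), (Summable fun i => ‖ζ i‖ ^ 2) ∧
      ∀ x ∈ M, HasSum (fun i => (inner ℂ (ζ i) (x (ζ i)) : ℂ)) (ψ x) := by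
  classical
  have hP := hψ.toIsPLF
  obtain ⟨S, hS⟩ := zorn_subset
    {S : Set (H × ℕ) | ∀ F : Finset (H × ℕ), (F : Set (H × ℕ)) ⊆ S → ∀ x ∈ M,
      ∑ s ∈ F, ‖x s.1‖ ^ 2 ≤ (ψ (star x * x)).re} (by
      intro c hc hchain
      refine ⟨⋃₀ c, fun F hF x hx => ?_, fun s hs => Set.subset_sUnion_of_mem hs⟩
      rcases c.eq_empty_or_nonempty with rfl | hne
      · have : F = ∅ := by simpa using hF
        simpa [this] using hP.re_nonneg hx
      obtain ⟨s, hs, hFs⟩ := DirectedOn.exists_mem_subset_of_finset_subset_biUnion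
        (f := id) hne hchain.directedOn (s := F) (by simpa [Set.sUnion_eq_biUnion] using hF)
      exact hc hs F hFs x hx)
  have hbd : ∀ x ∈ M, ∀ F : Finset S, ∑ s ∈ F, ‖x (s : H × ℕ).1‖ ^ 2 ≤ (ψ (star x * x)).re := by
    intro x hx F
    have := hS.prop (F.map (Function.Embedding.subtype _)) (by
      intro s hs
      simp only [Finset.coe_map, Set.mem_image] at hs
      obtain ⟨t, -, rfl⟩ := hs
      exact t.2) x hx
    rw [Finset.sum_map] at this
    exact this
  have hsumm : ∀ x ∈ M, Summable fun s : S => ‖x (s : H × ℕ).1‖ ^ 2 := fun x hx =>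
    summable_of_sum_le (fun _ => by positivity) (hbd x hx)
  have hsumm1 : Summable fun s : S => ‖(s : H × ℕ).1‖ ^ 2 := hsumm 1 (one_mem M)
  have hsummi := fun x : Op H => summable_inner_apply hsumm1 x
  let ω : Op H → ℂ := fun x => ∑' s : S, inner ℂ (s : H × ℕ).1 (x (s : H × ℕ).1)
  have hω : ∀ x, ω (star x * x) = ((∑' s : S, ‖x (s : H × ℕ).1‖ ^ 2 : ℝ) : ℂ) := by
    intro x
    simp only [ω, inner_star_mul_self, Complex.ofReal_tsum]
  have hρ : IsNormalPLF M fun x => ψ x - ω x := by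
    refine ⟨⟨fun x hx y hy => ?_, fun c x hx => ?_, fun x hx => ?_⟩,
      fun ι p q hp hq ho hs => ?_⟩
    · have : ω (x + y) = ω x + ω y := by
        simp only [ω, add_apply, inner_add_right]
        exact (hsummi x).tsum_add (hsummi y)
      rw [hP.map_add x hx y hy, this]
      ring
    · have : ω (c • x) = c * ω x := by
        simp only [ω, smul_apply, inner_smul_right, tsum_mul_left]
      rw [hP.map_smul c x hx, this]
      ring
    · rw [hω, ← hP.ofReal_re hx, sub_nonneg, Complex.real_le_real]
      exact (hsumm x hx).tsum_le_of_sum_le (hbd x hx)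
    · exact (hψ.normal ι p q hp hq ho hs).sub (hasSum_tsum_inner hsumm1 hp hs)
  have hρ1 : ψ 1 - ω 1 = 0 := by
    by_contra h1
    obtain ⟨η, hη0, hη⟩ := hρ.exists_vector_le h1
    obtain ⟨n, hn⟩ : ∃ n : ℕ, (η, n) ∉ S := by
      by_contra! hall
      have := hsumm1.comp_injective (i := fun n : ℕ => (⟨(η, n), hall n⟩ : S))
        fun a b hab => by simpa using hab
      have := summable_const_iff (β := ℕ) (a := ‖η‖ ^ 2) |>.1 this
      exact hη0 (by simpa using this)
    refine hn (hS.mem_of_prop_insert fun F hF x hx => ?_)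
    have h2 : ((F.erase (η, n) : Finset (H × ℕ)) : Set (H × ℕ)) ⊆ S := by
      intro s hs
      simp only [Finset.coe_erase, Set.mem_sdiff, Set.mem_singleton_iff] at hs
      exact (hF hs.1).resolve_left hs.2
    have h3 : ∑ s ∈ F.erase (η, n), ‖x s.1‖ ^ 2 ≤ (ω (star x * x)).re := by
      rw [hω, Complex.ofReal_re]
      have := (hsumm x hx).sum_le_tsum ((F.erase (η, n)).subtype (· ∈ S)) fun _ _ => by positivity
      refine le_trans (le_of_eq ?_) this
      rw [Finset.sum_subtype_of_mem (fun s : H × ℕ => ‖x s.1‖ ^ 2) fun s hs => h2 hs]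
    have h4 := hη x hx
    simp only [Complex.sub_re] at h4
    calc ∑ s ∈ F, ‖x s.1‖ ^ 2 ≤ ∑ s ∈ insert (η, n) (F.erase (η, n)), ‖x s.1‖ ^ 2 := by
          refine Finset.sum_le_sum_of_subset_of_nonneg ?_ fun _ _ _ => by positivity
          exact Finset.insert_erase_subset _ _
      _ = ‖x η‖ ^ 2 + ∑ s ∈ F.erase (η, n), ‖x s.1‖ ^ 2 :=
          Finset.sum_insert (Finset.notMem_erase _ _)
      _ ≤ _ := by linarith
  refine ⟨S, fun s => (s : H × ℕ).1, hsumm1, fun x hx => ?_⟩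
  have := hρ.toIsPLF.norm_le hx
  simp only [hρ1, Complex.zero_re, zero_mul, norm_le_zero_iff, sub_eq_zero] at this
  rw [this]
  exact (hsummi x).hasSum

section Normal

variable {M : VonNeumannAlgebra H} {ψ : Op H → ℂ}

/-- Normal functionals are continuous along bounded strongly convergent sequences. -/
theorem IsNormalPLF.tendsto (hψ : IsNormalPLF M ψ) {x : ℕ → Op H} {y : Op H} {C : ℝ}
    (hx : ∀ n, x n ∈ M) (hy : y ∈ M) (hC : ∀ n, ‖x n‖ ≤ C)
    (h : ∀ ξ, Filter.Tendsto (fun n => x n ξ) Filter.atTop (nhds (y ξ))) :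
    Filter.Tendsto (fun n => ψ (x n)) Filter.atTop (nhds (ψ y)) := by
  obtain ⟨ι, ζ, hζ, hψζ⟩ := hψ.exists_hasSum
  simp only [← (hψζ _ (hx _)).tsum_eq]
  rw [← (hψζ _ hy).tsum_eq]
  refine tendsto_tsum_of_dominated_convergence (hζ.mul_left C)
    (fun i => ((innerSL ℂ (ζ i)).continuous.tendsto _).comp (h (ζ i)))
    (Filter.Eventually.of_forall fun n i => ?_)
  calc ‖(inner ℂ (ζ i) (x n (ζ i)) : ℂ)‖ ≤ ‖ζ i‖ * ‖x n (ζ i)‖ := norm_inner_le_norm _ _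
    _ ≤ ‖ζ i‖ * (C * ‖ζ i‖) := by gcongr; exact (x n).le_of_opNorm_le (hC n) _
    _ = C * ‖ζ i‖ ^ 2 := by ring

/-- Normal positive functionals have a support projection. -/
theorem IsNormalPLF.exists_support (hψ : IsNormalPLF M ψ) : ∃ p, IsSupportProjOf M ψ p := by
  obtain ⟨ι, ζ, hζ, hψζ⟩ := hψ.exists_hasSum
  have hP := hψ.toIsPLF
  let A : Set H := {w | ∃ c ∈ M.commutant, ∃ i, w = c (ζ i)}
  let W : Submodule ℂ H := (Submodule.span ℂ A).topologicalClosure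
  have hWA : ∀ i, ζ i ∈ W := fun i => Submodule.le_topologicalClosure _
    (Submodule.subset_span ⟨1, one_mem _, i, rfl⟩)
  have hpM : W.starProjection ∈ M := by
    refine starProjection_mem M W fun c hc => ?_
    have h1 : Submodule.span ℂ A ≤ (Submodule.span ℂ A).comap c.toLinearMap := by
      refine Submodule.span_le.2 ?_
      rintro _ ⟨d, hd, i, rfl⟩
      exact Submodule.subset_span ⟨c * d, mul_mem hc hd, i, rfl⟩
    exact fun w hw => map_mem_closure c.continuous hw h1
  have hps : star W.starProjection = W.starProjection :=
    isStarProjection_starProjection.isSelfAdjoint.star_eq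
  refine ⟨W.starProjection, ⟨hpM, hps, isStarProjection_starProjection.isIdempotentElem⟩,
    fun x hx => ?_, fun q hq hqψ => ?_⟩
  · refine (hψζ _ (mul_mem (mul_mem hpM hx) hpM)).unique ?_
    convert hψζ x hx using 2 with i
    have : W.starProjection (ζ i) = ζ i := Submodule.starProjection_eq_self_iff.2 (hWA i)
    change inner ℂ (ζ i) (W.starProjection (x (W.starProjection (ζ i)))) = _
    rw [← inner_apply_of_star_eq hps, this]
  · have hq1 : star (1 - q) * (1 - q) = 1 - q := by
      simp [mul_sub, sub_mul, hq.2.2, hq.2.1]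
    have h0 : ψ (1 - q) = 0 := by
      rw [← hqψ _ (sub_mem (one_mem M) hq.1)]
      simp [mul_sub, hq.2.2, hP.map_zero]
    have h1 := Complex.reCLM.hasSum (hψζ _ (sub_mem (one_mem M) hq.1))
    rw [h0] at h1
    have h2 : ∀ i, (1 - q) (ζ i) = 0 := by
      intro i
      have e : ∀ i, (inner ℂ (ζ i) ((1 - q) (ζ i)) : ℂ).re = ‖(1 - q) (ζ i)‖ ^ 2 := by
        intro i
        rw [← Complex.ofReal_re (‖(1 - q) (ζ i)‖ ^ 2), ← inner_star_mul_self, hq1]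
      simp only [Complex.reCLM_apply, e, Complex.zero_re] at h1
      have := (hasSum_zero_iff_of_nonneg fun i => by positivity).1 h1
      simpa using congrFun this i
    have h3 : ∀ w ∈ W, q w = w := by
      intro w hw
      refine closure_minimal (s := (Submodule.span ℂ A : Set H)) (t := {w | q w = w}) ?_
        (isClosed_eq q.continuous continuous_id) hw
      change Submodule.span ℂ A ≤ LinearMap.eqLocus q.toLinearMap LinearMap.id
      refine Submodule.span_le.2 ?_
      rintro _ ⟨c, hc, i, rfl⟩
      have e1 : q (c (ζ i)) = c (q (ζ i)) :=
        congrArg (fun T : Op H => T (ζ i)) (commutant_comm hc hq.1)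
      have e2 : ζ i = q (ζ i) := sub_eq_zero.1 (h2 i)
      change q (c (ζ i)) = c (ζ i)
      rw [e1, ← e2]
    have h4 : q * W.starProjection = W.starProjection :=
      ContinuousLinearMap.ext fun ξ => h3 _ (W.starProjection_apply_mem ξ)
    have := congrArg star h4
    rwa [star_mul, hq.2.1, hps] at this

theorem IsSupportProjOf.apply_mul_left {p : Op H} (h : IsPLF M ψ) (hp : IsSupportProjOf M ψ p)
    {x : Op H} (hx : x ∈ M) : ψ (p * x) = ψ x := by
  obtain ⟨⟨hpM, hps, hpp⟩, h1, -⟩ := hp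
  have h2 : (1 - p) * star (1 - p) = 1 - p := by simp [mul_sub, sub_mul, hpp, hps]
  have h3 : ψ ((1 - p) * x) = 0 := by
    refine h.eq_zero_of_left (sub_mem (one_mem M) hpM) hx ?_
    rw [h2, ← h1 _ (sub_mem (one_mem M) hpM)]
    simp [mul_sub, hpp, h.map_zero]
  rw [sub_mul, one_mul, h.map_sub hx (mul_mem hpM hx), sub_eq_zero] at h3
  exact h3.symm

theorem IsSupportProjOf.apply_mul_right {p : Op H} (h : IsPLF M ψ) (hp : IsSupportProjOf M ψ p)
    {x : Op H} (hx : x ∈ M) : ψ (x * p) = ψ x := by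
  have h1 := hp.apply_mul_left h (star_mem hx)
  have h2 := h.conj_star (mul_mem hx hp.1.1)
  rw [star_mul, hp.1.2.1, h1, h.conj_star hx] at h2
  exact (RingHom.injective _ h2).symm

/-- The centralizer of a positive functional. -/
noncomputable def centralizerAlg (h : IsPLF M ψ) : StarSubalgebra ℂ (Op H) where
  carrier := stateCentralizer M ψ
  mul_mem' := by
    rintro a b ⟨ha, ha'⟩ ⟨hb, hb'⟩
    refine ⟨mul_mem ha hb, fun y hy => ?_⟩
    rw [mul_assoc, ha' _ (mul_mem hb hy), mul_assoc, hb' _ (mul_mem hy ha), mul_assoc]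
  add_mem' := by
    rintro a b ⟨ha, ha'⟩ ⟨hb, hb'⟩
    refine ⟨add_mem ha hb, fun y hy => ?_⟩
    rw [add_mul, mul_add, h.map_add _ (mul_mem ha hy) _ (mul_mem hb hy),
      h.map_add _ (mul_mem hy ha) _ (mul_mem hy hb), ha' y hy, hb' y hy]
  algebraMap_mem' := fun c => by
    refine ⟨?_, fun y _ => ?_⟩
    · rw [Algebra.algebraMap_eq_smul_one]
      exact smul_mem_vna M c (one_mem M)
    · rw [Algebra.commutes]
  star_mem' := by
    rintro a ⟨ha, ha'⟩
    refine ⟨star_mem ha, fun y hy => ?_⟩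
    have e1 := h.conj_star (mul_mem ha (star_mem hy))
    have e2 := h.conj_star (mul_mem (star_mem hy) ha)
    rw [star_mul, star_star] at e1 e2
    rw [e2, e1, ha' _ (star_mem hy)]

theorem isClosed_centralizerAlg (h : IsPLF M ψ) : IsClosed (centralizerAlg h : Set (Op H)) := by
  refine isClosed_of_closure_subset fun x hx => ?_
  have hxM : x ∈ M := (isClosed_vna M).closure_subset_iff.2 (fun y hy => hy.1) hx
  refine ⟨hxM, fun y hy => ?_⟩
  rw [← sub_eq_zero, ← norm_le_zero_iff]
  obtain ⟨u, hu, hlim⟩ := mem_closure_iff_seq_limit.1 hx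
  have hb : ∀ n, ‖ψ (x * y) - ψ (y * x)‖ ≤ 2 * ((ψ 1).re * ‖y‖ * ‖u n - x‖) := by
    intro n
    have hd := sub_mem (hu n).1 hxM
    have e : ψ (x * y) - ψ (y * x) = ψ (y * (u n - x)) - ψ ((u n - x) * y) := by
      rw [mul_sub, sub_mul, h.map_sub (mul_mem hy (hu n).1) (mul_mem hy hxM),
        h.map_sub (mul_mem (hu n).1 hy) (mul_mem hxM hy), (hu n).2 y hy]
      ring
    have h1 := h.norm_le (mul_mem hy hd)
    have h2 := h.norm_le (mul_mem hd hy)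
    have h3 := h.one_nonneg
    have h4 := mul_le_mul_of_nonneg_left (norm_mul_le y (u n - x)) h3
    have h5 := mul_le_mul_of_nonneg_left (norm_mul_le (u n - x) y) h3
    rw [e]
    refine (norm_sub_le _ _).trans ?_
    linarith
  have hl : Filter.Tendsto (fun n => 2 * ((ψ 1).re * ‖y‖ * ‖u n - x‖)) Filter.atTop (nhds 0) := by
    have := ((tendsto_iff_norm_sub_tendsto_zero.1 hlim).const_mul ((ψ 1).re * ‖y‖)).const_mul 2
    simpa using this
  exact ge_of_tendsto' hl hb

theorem cfc_mem_centralizerAlg (h : IsPLF M ψ) {x : Op H} (hx : x ∈ centralizerAlg h)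
    (f : ℝ → ℝ) : cfc f x ∈ centralizerAlg h :=
  cfc_mem (S := StarSubalgebra ℂ (Op H)) (s := centralizerAlg h) (𝕜' := ℂ)
    (hs := isClosed_centralizerAlg h) f hx

/-- Support projections of contractions in the centralizer lie in the centralizer. -/
theorem suppProj_mem_centralizerAlg (hψ : IsNormalPLF M ψ) {y : Op H}
    (hy : y ∈ centralizerAlg hψ.toIsPLF) (h0 : 0 ≤ y) (h1 : y ≤ 1) :
    suppProj y ∈ centralizerAlg hψ.toIsPLF := by
  set C := centralizerAlg hψ.toIsPLF
  have hTC : 1 - y ∈ C := sub_mem (one_mem C) hy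
  have hT : ‖1 - y‖ ≤ 1 := (CStarAlgebra.norm_le_one_iff_of_nonneg (1 - y) (sub_nonneg.2 h1)).2
    (sub_le_self 1 h0)
  set T : Op H := 1 - y
  let A : ℕ → Op H := fun n => (n : ℂ)⁻¹ • ∑ k ∈ Finset.range n, T ^ k
  have hAC : ∀ n, A n ∈ C := fun n =>
    C.smul_mem (sum_mem fun k _ => pow_mem hTC k) _
  have hAM : ∀ n, A n ∈ M := fun n => (hAC n).1
  have hA1 : ∀ n, ‖A n‖ ≤ 1 := by
    intro n
    rcases Nat.eq_zero_or_pos n with rfl | hn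
    · simp [A]
    have : ‖∑ k ∈ Finset.range n, T ^ k‖ ≤ n := by
      refine (norm_sum_le_of_le (n := fun _ => (1 : ℝ)) _ fun k _ => ?_).trans (by simp)
      rcases Nat.eq_zero_or_pos k with rfl | hk
      · exact ContinuousLinearMap.norm_id_le (𝕜 := ℂ) (E := H)
      · exact (norm_pow_le' T hk).trans (pow_le_one₀ (norm_nonneg _) hT)
    have hn' : (0 : ℝ) < n := by exact_mod_cast hn
    simp only [A]
    rw [norm_smul, norm_inv, Complex.norm_natCast, inv_mul_le_iff₀ hn', mul_one]
    exact this
  have hlim : ∀ ξ, Filter.Tendsto (fun n => A n ξ) Filter.atTop (nhds ((1 - suppProj y) ξ)) := by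
    intro ξ
    have h := ContinuousLinearMap.tendsto_birkhoffAverage_orthogonalProjection T hT ξ
    have e : T.eqLocus (1 : Op H) = y.ker := by
      ext w
      change w - y w = w ↔ y w = 0
      rw [sub_eq_self]
    have e2 : (((T.eqLocus (1 : Op H)).orthogonalProjectionOnto ξ : H)) = (1 - suppProj y) ξ := by
      change (T.eqLocus (1 : Op H)).starProjection ξ = _
      simp only [e, suppProj, sub_sub_cancel]
    rw [e2] at h
    refine h.congr fun n => ?_
    simp only [birkhoffAverage, birkhoffSum, A, smul_apply, sum_apply, id]
    congr 1
    refine Finset.sum_congr rfl fun k _ => ?_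
    exact (congrFun (hom_coe_pow (fun f : Op H => ⇑f) rfl (fun _ _ => rfl) T k) ξ).symm
  have hpM : suppProj y ∈ M := suppProj_mem M hy.1
  have hqM : 1 - suppProj y ∈ M := sub_mem (one_mem M) hpM
  suffices h : 1 - suppProj y ∈ C by
    have := sub_mem (one_mem C) h
    rwa [sub_sub_cancel] at this
  refine ⟨hqM, fun z hz => ?_⟩
  have l1 := hψ.tendsto (x := fun n => A n * z) (y := (1 - suppProj y) * z) (C := ‖z‖)
    (fun n => mul_mem (hAM n) hz) (mul_mem hqM hz)
    (fun n => (norm_mul_le _ _).trans (mul_le_of_le_one_left (norm_nonneg _) (hA1 n)))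
    (fun ξ => hlim (z ξ))
  have l2 := hψ.tendsto (x := fun n => z * A n) (y := z * (1 - suppProj y)) (C := ‖z‖)
    (fun n => mul_mem hz (hAM n)) (mul_mem hz hqM)
    (fun n => (norm_mul_le _ _).trans (mul_le_of_le_one_right (norm_nonneg _) (hA1 n)))
    (fun ξ => (z.continuous.tendsto _).comp (hlim ξ))
  simp only [(hAC _).2 z hz] at l1
  exact tendsto_nhds_unique l1 l2

end Normal

/-- The function `t ↦ max(t, 1/2)^{-1/2}` applied to `x`. -/
noncomputable def cutInvSqrt (x : Op H) : Op H :=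
  cfc (fun t : ℝ => (Real.sqrt (max t (1 / 2)))⁻¹) x

theorem cutInvSqrt_mul_mul {x : Op H} (h0 : 0 ≤ x) (h1 : x ≤ 1) :
    cutInvSqrt x * x * cutInvSqrt x = 1 - lowerPart x := by
  have hs : IsSelfAdjoint x := h0.isSelfAdjoint
  have hc : Continuous fun t : ℝ => (Real.sqrt (max t (1 / 2)))⁻¹ := by
    refine Continuous.inv₀ (by fun_prop) fun t => ?_
    have : (0 : ℝ) < max t (1 / 2) := lt_max_of_lt_right (by norm_num)
    positivity
  have hl : Continuous fun t : ℝ => max (1 - 2 * t) 0 := by fun_prop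
  have e1 : (1 : Op H) = cfc (fun _ : ℝ => (1 : ℝ)) x := (cfc_const_one ℝ x).symm
  unfold cutInvSqrt lowerPart
  rw [e1, ← cfc_sub (fun _ : ℝ => (1 : ℝ)) _ x (by fun_prop) hl.continuousOn]
  conv_lhs => enter [1, 2]; rw [← cfc_id' ℝ x]
  rw [← cfc_mul _ (fun t : ℝ => t) x hc.continuousOn continuousOn_id,
    ← cfc_mul (fun t : ℝ => (Real.sqrt (max t (1 / 2)))⁻¹ * t) _ x
      (hc.mul continuous_id).continuousOn hc.continuousOn]
  refine cfc_congr fun t ht => ?_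
  obtain ⟨t0, t1⟩ := spectrum_mem_unit h0 h1 ht
  have hm : (0 : ℝ) < max t (1 / 2) := lt_max_of_lt_right (by norm_num)
  have h2 : (Real.sqrt (max t (1 / 2)))⁻¹ * t * (Real.sqrt (max t (1 / 2)))⁻¹
      = t / max t (1 / 2) := by
    rw [mul_right_comm, ← mul_inv, Real.mul_self_sqrt hm.le, inv_mul_eq_div]
  rw [h2]
  rcases le_total t (1 / 2) with h | h
  · rw [max_eq_right h, max_eq_left (by linarith)]; ring
  · rw [max_eq_left h, max_eq_right (by linarith), div_self (by linarith)]; ring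

theorem star_cutInvSqrt (x : Op H) : star (cutInvSqrt x) = cutInvSqrt x :=
  (cfc_predicate (p := IsSelfAdjoint) _ x).star_eq

theorem suppProj_upperPart_ne_zero {x : Op H} (h0 : 0 ≤ x) (hn : ‖x‖ = 1) :
    suppProj (upperPart x) ≠ 0 := by
  intro he
  have hu : upperPart x = 0 := by rw [← suppProj_upperPart_mul, he, zero_mul]
  have h2 : x + x ≤ 1 := by
    have := upperPart_sub_lowerPart h0
    rw [hu, zero_sub] at this
    have hl : 0 ≤ lowerPart x := lowerPart_nonneg
    rw [← sub_nonpos, ← this]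
    exact neg_nonpos.2 hl
  have h3 : ‖x + x‖ ≤ 1 :=
    (CStarAlgebra.norm_le_one_iff_of_nonneg (x + x) (add_nonneg h0 h0)).2 h2
  rw [← two_smul ℝ x, norm_smul, hn] at h3
  norm_num at h3

/-- A nonzero element intertwining `ψ'` and `ψ` has a spectral cut of its polar part which is an
intertwining partial isometry. -/
theorem intertwined_of_supported {N : VonNeumannAlgebra H} {ψ ψ' : Op H → ℂ}
    (hψ : IsNormalPLF N ψ) (hψ' : IsPLF N ψ') {p q a : Op H} {μ : ℝ} (hμ : 0 < μ)
    (hq : IsSupportProjOf N ψ' q) (hp : IsSupportProjOf N ψ p) (ha : a ∈ N) (ha0 : a ≠ 0)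
    (hqa : q * a = a) (hap : a * p = a) (h : ∀ x ∈ N, ψ' (a * x) = μ * ψ (x * a)) :
    Intertwined N ψ' ψ := by
  have hP := hψ.toIsPLF
  have hpos : 0 < ‖a‖ := norm_pos_iff.2 ha0
  have hsa : star a ∈ N := star_mem ha
  have hμ0 : (μ : ℂ) ≠ 0 := by exact_mod_cast hμ.ne'
  have haa : star a * a ∈ centralizerAlg hP := by
    refine ⟨mul_mem hsa ha, fun y hy => ?_⟩
    have hsy : star y ∈ N := star_mem hy
    have e1 : ψ (star a * a * y) = (starRingEnd ℂ) (ψ (star y * star a * a)) := by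
      rw [← hP.conj_star (mul_mem (mul_mem hsy hsa) ha)]
      simp [mul_assoc]
    have e2 : ∀ z ∈ N, ψ (z * a) = (μ : ℂ)⁻¹ * ψ' (a * z) := fun z hz => by
      rw [h z hz, inv_mul_cancel_left₀ hμ0]
    rw [e1, e2 _ (mul_mem hsy hsa), ← mul_assoc y, e2 _ (mul_mem hy hsa), map_mul,
      ← hψ'.conj_star (mul_mem ha (mul_mem hsy hsa))]
    simp [mul_assoc]
  set c : ℝ := (‖a‖ ^ 2)⁻¹ with hc
  have hc0 : 0 < c := by positivity
  set x : Op H := (c : ℂ) • (star a * a) with hx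
  have hxC : x ∈ centralizerAlg hP := (centralizerAlg hP).smul_mem haa _
  have h0 : 0 ≤ x := smul_nonneg (by exact_mod_cast hc0.le) (star_mul_self_nonneg a)
  have hn : ‖x‖ = 1 := by
    rw [hx, norm_smul, CStarRing.norm_star_mul_self, Complex.norm_real, Real.norm_of_nonneg hc0.le,
      hc, ← sq, inv_mul_cancel₀ (by positivity)]
  have h1 : x ≤ 1 := (CStarAlgebra.norm_le_one_iff_of_nonneg x h0).1 hn.le
  set e := suppProj (upperPart x) with he
  have heC : e ∈ centralizerAlg hP := suppProj_mem_centralizerAlg hψ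
    (cfc_mem_centralizerAlg hP hxC _) upperPart_nonneg (upperPart_le_one h0 h1)
  have hhC : cutInvSqrt x ∈ centralizerAlg hP := cfc_mem_centralizerAlg hP hxC _
  have hes : star e = e := suppProj_star _
  have hee : e * e = e := suppProj_mul_self _
  set g := cutInvSqrt x
  have hgs : star g = g := star_cutInvSqrt x
  have hgeC : g * e ∈ centralizerAlg hP := mul_mem hhC heC
  set w : Op H := (Real.sqrt c : ℂ) • (a * (g * e)) with hw
  have hsc : (Real.sqrt c : ℂ) * (Real.sqrt c : ℂ) = c := by
    exact_mod_cast Real.mul_self_sqrt hc0.le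
  have hww : star w * w = e := by
    have e1 : star w * w = e * (g * x * g) * e := by
      rw [hw, hx]
      simp only [star_smul, star_mul, hes, hgs, smul_mul_assoc, mul_smul_comm, smul_smul,
        mul_assoc]
      congr 1
      rw [Complex.star_def, Complex.conj_ofReal, hsc]
    rw [e1, cutInvSqrt_mul_mul h0 h1, mul_sub, mul_one, he, suppProj_mul_lowerPart, sub_zero, ← he,
      hee]
  have hxp : (x + x) * (1 - p) = 0 := by
    have : x * (1 - p) = 0 := by
      rw [hx, smul_mul_assoc, mul_assoc, mul_sub, mul_one, hap, sub_self, mul_zero, smul_zero]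
    rw [add_mul, this, add_zero]
  have hep : e * p = e := by
    have := mul_eq_zero_of_le hes hee (suppProj_le_add_self h0 h1) hxp
    rw [mul_sub, mul_one, sub_eq_zero] at this
    exact this.symm
  refine ⟨w, q, p, μ, hμ, smul_mem_vna N _ (mul_mem ha hgeC.1), ?_, ?_, hq, hp, ?_, ?_, ?_⟩
  · rw [IsPartialIsom, hww, hee]
  · rintro h0w
    apply suppProj_upperPart_ne_zero h0 hn
    rw [← he, ← hww, h0w, mul_zero]
  · rw [hw, mul_smul_comm, ← mul_assoc, hqa]
  · rw [hw, smul_mul_assoc, mul_assoc, mul_assoc, hep]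
  · intro z hz
    have hgez := mul_mem hgeC.1 hz
    rw [hw, smul_mul_assoc, mul_smul_comm, hψ'.map_smul _ _ (mul_mem (mul_mem ha hgeC.1) hz),
      mul_assoc, h _ hgez, hP.map_smul _ _ (mul_mem hz (mul_mem ha hgeC.1)), mul_assoc (g * e),
      hgeC.2 _ (mul_mem hz ha), mul_assoc z]
    ring

/-- An element of `N` intertwining `ψ'` and `ψ`, and not annihilated by `ψ`, can be cut down to a
partial isometry with the same property. -/
theorem intertwined_of_exists {N : VonNeumannAlgebra H} {ψ ψ' : Op H → ℂ}
    (hψ : IsNormalPLF N ψ) (hψ' : IsPLF N ψ') {q a : Op H} {μ : ℝ} (hμ : 0 < μ)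
    (hq : IsSupportProjOf N ψ' q) (ha : a ∈ N) (ha0 : ψ (star a * a) ≠ 0)
    (h : ∀ x ∈ N, ψ' (a * x) = μ * ψ (x * a)) : Intertwined N ψ' ψ := by
  obtain ⟨p, hp⟩ := hψ.exists_support
  have hP := hψ.toIsPLF
  have hsa : star a ∈ N := star_mem ha
  have hqN := hq.1.1
  have hpN := hp.1.1
  have hμ0 : (μ : ℂ) ≠ 0 := by exact_mod_cast hμ.ne'
  have e2 : ∀ z ∈ N, ψ (z * a) = (μ : ℂ)⁻¹ * ψ' (a * z) := fun z hz => by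
    rw [h z hz, inv_mul_cancel_left₀ hμ0]
  have key : ∀ z ∈ N, ψ (z * q * a) = ψ (z * a) := fun z hz => by
    rw [e2 _ (mul_mem hz hqN), e2 _ hz, ← mul_assoc, hq.apply_mul_right hψ' (mul_mem ha hz)]
  refine intertwined_of_supported hψ hψ' (a := q * a * p) hμ hq hp (mul_mem (mul_mem hqN ha) hpN)
    ?_ (by rw [← mul_assoc, ← mul_assoc, hq.1.2.2]) (by rw [mul_assoc, hp.1.2.2]) fun x hx => ?_
  · intro h0
    have h1 : ψ (star a * (q * a * p)) = ψ (star a * a) := by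
      rw [← mul_assoc, hp.apply_mul_right hP (mul_mem hsa (mul_mem hqN ha)), ← mul_assoc,
        key _ hsa]
    rw [h0, mul_zero, hP.map_zero] at h1
    exact ha0 h1.symm
  · rw [mul_assoc, mul_assoc, hq.apply_mul_left hψ' (mul_mem ha (mul_mem hpN hx)),
      h _ (mul_mem hpN hx), mul_assoc p, hp.apply_mul_left hP (mul_mem hx ha), ← mul_assoc x,
      ← mul_assoc x, hp.apply_mul_right hP (mul_mem (mul_mem hx hqN) ha), key _ hx]

/-! ### Amplifications and density of algebraic tensors -/

/-- The Hilbert sum of copies of `H` indexed by `ι`. -/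
abbrev HilbertSum (ι H : Type) [NormedAddCommGroup H] : Type := lp (fun _ : ι => H) 2

section Ampl

variable {ι : Type}

/-- The diagonal amplification of an operator to the Hilbert sum. -/
noncomputable def ampl (x : Op H) : HilbertSum ι H →L[ℂ] HilbertSum ι H :=
  LinearMap.mkContinuous
    { toFun := fun f => ⟨fun i => x (f i), ((lp.memℓp f).norm.const_mul ‖x‖).mono
        fun i => x.le_opNorm (f i)⟩
      map_add' := fun f g => by ext i; exact map_add x (f i) (g i)
      map_smul' := fun c f => by ext i; exact map_smul x c (f i) } ‖x‖ fun f => by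
    refine lp.norm_le_of_forall_sum_le (by norm_num) (by positivity) fun s => ?_
    simp only [ENNReal.toReal_ofNat, Real.rpow_two]
    calc ∑ i ∈ s, ‖x (f i)‖ ^ 2 ≤ ∑ i ∈ s, ‖x‖ ^ 2 * ‖f i‖ ^ 2 := by
          gcongr with i
          rw [← mul_pow]
          gcongr
          exact x.le_opNorm _
      _ = ‖x‖ ^ 2 * ∑ i ∈ s, ‖f i‖ ^ (2 : ℝ≥0∞).toReal := by
          simp [Finset.mul_sum]
      _ ≤ ‖x‖ ^ 2 * ‖f‖ ^ (2 : ℝ≥0∞).toReal := by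
          gcongr
          exact lp.sum_rpow_le_norm_rpow (by norm_num) f s
      _ = (‖x‖ * ‖f‖) ^ 2 := by simp [mul_pow]

@[simp] theorem ampl_apply (x : Op H) (f : HilbertSum ι H) (i : ι) : ampl x f i = x (f i) := rfl

theorem ampl_add (x y : Op H) (f : HilbertSum ι H) : ampl (x + y) f = ampl x f + ampl y f := rfl

theorem ampl_smul (c : ℂ) (x : Op H) (f : HilbertSum ι H) : ampl (c • x) f = c • ampl x f := rfl

theorem ampl_mul (x y : Op H) (f : HilbertSum ι H) : ampl (x * y) f = ampl x (ampl y f) := rfl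

theorem ampl_single [DecidableEq ι] (x : Op H) (i : ι) (a : H) :
    ampl x (lp.single 2 i a) = lp.single 2 i (x a) := by
  ext j
  rw [ampl_apply]
  rcases eq_or_ne j i with rfl | h
  · simp
  · rw [lp.single_apply_ne _ _ _ h, lp.single_apply_ne _ _ _ h, _root_.map_zero]

theorem inner_ampl_right (x : Op H) (f g : HilbertSum ι H) :
    (inner ℂ f (ampl x g) : ℂ) = inner ℂ (ampl (star x) f) g := by
  rw [lp.inner_eq_tsum, lp.inner_eq_tsum]
  refine tsum_congr fun i => ?_
  rw [ampl_apply, ampl_apply, inner_star_left]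

/-- A closed subspace invariant under a self-adjoint set is invariant under its bicommutant. -/
theorem ampl_mem_of_invariant {S : Set (Op H)} (hS : ∀ x ∈ S, star x ∈ S)
    (W : Submodule ℂ (HilbertSum ι H)) (hW : IsClosed (W : Set (HilbertSum ι H)))
    (hinv : ∀ x ∈ S, ∀ w ∈ W, ampl x w ∈ W) {T : Op H}
    (hT : T ∈ Set.centralizer (Set.centralizer S)) {w : HilbertSum ι H} (hw : w ∈ W) :
    ampl T w ∈ W := by
  classical
  have : CompleteSpace W := hW.completeSpace_coe
  let Q := W.starProjection
  have hQ : ∀ x ∈ S, ∀ v, Q (ampl x v) = ampl x (Q v) := fun x hx v => by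
    refine Submodule.eq_starProjection_of_mem_orthogonal (hinv x hx _ (W.starProjection_apply_mem v))
      fun u hu => ?_
    rw [← map_sub, inner_ampl_right]
    exact W.sub_starProjection_mem_orthogonal v _ (hinv _ (hS x hx) u hu)
  let Qij : ι → ι → Op H := fun i j =>
    (lp.evalCLM ℂ (fun _ : ι => H) 2 i).comp
      (Q.comp (lp.singleContinuousLinearMap ℂ (fun _ : ι => H) 2 j))
  have hQij : ∀ i j a, Qij i j a = Q (lp.single 2 j a) i := fun i j a => rfl
  have hc : ∀ i j, Qij i j ∈ Set.centralizer S := fun i j x hx => by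
    ext a
    change x (Qij i j a) = Qij i j (x a)
    rw [hQij, hQij, ← ampl_single, hQ x hx, ampl_apply]
  have hQT : Q.comp (ampl T) = (ampl T).comp Q := by
    refine lp.ext_continuousLinearMap (by norm_num) fun j => ?_
    ext a i
    have h1 := congrArg (fun y : Op H => y a) (hT _ (hc i j))
    change Qij i j (T a) = T (Qij i j a) at h1
    change Q (ampl T (lp.single 2 j a)) i = ampl T (Q (lp.single 2 j a)) i
    rw [ampl_single, ampl_apply, ← hQij, ← hQij, h1]
  have hQw : Q w = w := Submodule.starProjection_eq_self_iff.2 hw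
  have h2 : Q (ampl T w) = ampl T (Q w) := congrArg (fun y => y w) hQT
  rw [hQw] at h2
  rw [← h2]
  exact W.starProjection_apply_mem _

end Ampl

/-- The algebraic tensor product `N ⊙ P`. -/
def tensorSpan (N P : VonNeumannAlgebra H) : Submodule ℂ (Op H) :=
  Submodule.span ℂ {z | ∃ x ∈ N, ∃ y ∈ P, z = x * y}

section Tensor

variable {M N P : VonNeumannAlgebra H}

theorem mul_mem_tensorSpan {x y : Op H} (hx : x ∈ N) (hy : y ∈ P) : x * y ∈ tensorSpan N P :=
  Submodule.subset_span ⟨x, hx, y, hy, rfl⟩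

theorem tensorSpan_le (h : IsTensorDecomposition M N P) {z : Op H} (hz : z ∈ tensorSpan N P) :
    z ∈ M := by
  refine Submodule.span_induction (p := fun z _ => z ∈ M) ?_ (zero_mem M)
    (fun _ _ _ _ => add_mem) (fun c _ _ hx => smul_mem_vna M c hx) hz
  rintro _ ⟨x, hx, y, hy, rfl⟩
  exact mul_mem (h.subN hx) (h.subP hy)

theorem mul_mem_tensorSpan_left (h : IsTensorDecomposition M N P) {g z : Op H}
    (hg : g ∈ (N : Set (Op H)) ∪ P) (hz : z ∈ tensorSpan N P) : g * z ∈ tensorSpan N P := by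
  refine Submodule.span_induction (p := fun z _ => g * z ∈ tensorSpan N P) ?_ (by simp)
    (fun _ _ _ _ hx hy => by rw [mul_add]; exact add_mem hx hy)
    (fun c _ _ hx => by rw [mul_smul_comm]; exact Submodule.smul_mem _ c hx) hz
  rintro _ ⟨x, hx, y, hy, rfl⟩
  rcases hg with hg | hg
  · rw [← mul_assoc]; exact mul_mem_tensorSpan (mul_mem hg hx) hy
  · rw [← mul_assoc, ← h.comm x hx g hg, mul_assoc]; exact mul_mem_tensorSpan hx (mul_mem hg hy)

theorem ampl_mem_closure (h : IsTensorDecomposition M N P) {T : Op H} (hT : T ∈ M) {ι : Type}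
    (ζ : HilbertSum ι H) :
    ampl T ζ ∈ closure ((fun a => ampl a ζ) '' (tensorSpan N P : Set (Op H))) := by
  let f : Op H →ₗ[ℂ] HilbertSum ι H :=
    { toFun := fun a => ampl a ζ
      map_add' := fun x y => ampl_add x y ζ
      map_smul' := fun c x => ampl_smul c x ζ }
  let W := ((tensorSpan N P).map f).topologicalClosure
  have hTW : ampl T ζ ∈ W := by
    refine ampl_mem_of_invariant (S := (N : Set (Op H)) ∪ P) ?_ W
      (Submodule.isClosed_topologicalClosure _) ?_ ?_ ?_
    · rintro x (hx | hx)
      · exact Or.inl (star_mem (S := VonNeumannAlgebra H) hx)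
      · exact Or.inr (star_mem (S := VonNeumannAlgebra H) hx)
    · intro x hx w hw
      refine map_mem_closure (ampl x).continuous hw ?_
      rintro _ ⟨a, ha, rfl⟩
      exact ⟨x * a, mul_mem_tensorSpan_left h hx ha, rfl⟩
    · rw [h.generates]; exact hT
    · refine subset_closure ⟨1, ?_, rfl⟩
      simpa using mul_mem_tensorSpan (one_mem N) (one_mem P)
  exact hTW

theorem exists_tensorSpan_norm_lt (h : IsTensorDecomposition M N P) {T : Op H} (hT : T ∈ M)
    {ι : Type} (ζ : HilbertSum ι H) {ε : ℝ} (hε : 0 < ε) :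
    ∃ a ∈ tensorSpan N P, ‖ampl (T - a) ζ‖ < ε := by
  obtain ⟨_, ⟨a, ha, rfl⟩, h'⟩ := Metric.mem_closure_iff.1 (ampl_mem_closure h hT ζ) ε hε
  exact ⟨a, ha, by rwa [dist_eq_norm] at h'⟩

/-- Normal functionals agreeing on algebraic tensors agree. -/
theorem inner_ampl_eq_zero (h : IsTensorDecomposition M N P) {ι : Type}
    (η ζ : HilbertSum ι H) (h0 : ∀ a ∈ tensorSpan N P, (inner ℂ η (ampl a ζ) : ℂ) = 0)
    {T : Op H} (hT : T ∈ M) : (inner ℂ η (ampl T ζ) : ℂ) = 0 := by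
  have hc : IsClosed {w : HilbertSum ι H | (inner ℂ η w : ℂ) = 0} :=
    isClosed_eq (by fun_prop) continuous_const
  refine closure_minimal ?_ hc (ampl_mem_closure h hT ζ)
  rintro _ ⟨a, ha, rfl⟩
  exact h0 a ha

/-- Concatenation of two square-summable families. -/
noncomputable def hsumPair {ι : Type} (f g : HilbertSum ι H) : HilbertSum (ι ⊕ ι) H :=
  ⟨Sum.elim f g, memℓp_gen (by
    have h1 := (memℓp_gen_iff (by norm_num)).1 (lp.memℓp f)
    have h2 := (memℓp_gen_iff (by norm_num)).1 (lp.memℓp g)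
    exact (h1.hasSum.sum (f := fun i => ‖(Sum.elim f g : ι ⊕ ι → H) i‖ ^ (2 : ℝ≥0∞).toReal)
      h2.hasSum).summable)⟩

theorem inner_hsumPair {ι : Type} (f g f' g' : HilbertSum ι H) (x : Op H) :
    (inner ℂ (hsumPair f g) (ampl x (hsumPair f' g')) : ℂ)
      = inner ℂ f (ampl x f') + inner ℂ g (ampl x g') := by
  have h1 := lp.hasSum_inner (𝕜 := ℂ) f (ampl x f')
  have h2 := lp.hasSum_inner (𝕜 := ℂ) g (ampl x g')
  exact (lp.hasSum_inner (𝕜 := ℂ) (hsumPair f g) (ampl x (hsumPair f' g'))).unique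
    (h1.sum (f := fun i => inner ℂ (hsumPair f g i) (ampl x (hsumPair f' g') i)) h2)

theorem inner_ampl_eq (h : IsTensorDecomposition M N P) {ι : Type}
    (η ζ η' ζ' : HilbertSum ι H)
    (h0 : ∀ a ∈ tensorSpan N P, (inner ℂ η (ampl a ζ) : ℂ) = inner ℂ η' (ampl a ζ'))
    {T : Op H} (hT : T ∈ M) : (inner ℂ η (ampl T ζ) : ℂ) = inner ℂ η' (ampl T ζ') := by
  have := inner_ampl_eq_zero h (hsumPair η (-η')) (hsumPair ζ ζ')
    (fun a ha => by rw [inner_hsumPair, h0 a ha, inner_neg_left, add_neg_cancel]) hT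
  rwa [inner_hsumPair, inner_neg_left, add_neg_eq_zero] at this

theorem IsNormalPLF.exists_hilbertSum {ψ : Op H → ℂ} (hψ : IsNormalPLF M ψ) :
    ∃ (ι : Type) (ζ : HilbertSum ι H), ∀ x ∈ M, ψ x = inner ℂ ζ (ampl x ζ) := by
  obtain ⟨ι, ζ, hζ, h⟩ := hψ.exists_hasSum
  refine ⟨ι, ⟨ζ, memℓp_gen (by simpa using hζ)⟩, fun x hx => ?_⟩
  exact (h x hx).unique (lp.hasSum_inner (𝕜 := ℂ) _ (ampl x _))

theorem inner_ampl_star_mul {ι : Type} (x y : Op H) (ζ : HilbertSum ι H) :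
    (inner ℂ ζ (ampl (star x * y) ζ) : ℂ) = inner ℂ (ampl x ζ) (ampl y ζ) := by
  rw [ampl_mul, inner_ampl_right, star_star]

end Tensor

/-! ### Conditional expectations -/

namespace IsCondExp

variable {M N : VonNeumannAlgebra H} {E : Op H → Op H}

theorem map_zero (h : IsCondExp M N E) : E 0 = 0 := h.fix' 0 (zero_mem N)

theorem map_neg (h : IsCondExp M N E) {x : Op H} (hx : x ∈ M) : E (-x) = -E x := by
  rw [← neg_one_smul ℂ x, h.map_smul' _ _ hx, neg_one_smul]

theorem map_sub (h : IsCondExp M N E) {x y : Op H} (hx : x ∈ M) (hy : y ∈ M) :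
    E (x - y) = E x - E y := by
  rw [sub_eq_add_neg, h.map_add' _ hx _ (neg_mem hy), h.map_neg hy, ← sub_eq_add_neg]

theorem map_mul_left (h : IsCondExp M N E) {a x : Op H} (ha : a ∈ N) (hx : x ∈ M) :
    E (a * x) = a * E x := by
  simpa using h.bimod' a ha x hx 1 (one_mem N)

theorem map_mul_right (h : IsCondExp M N E) {x b : Op H} (hx : x ∈ M) (hb : b ∈ N) :
    E (x * b) = E x * b := by
  simpa using h.bimod' 1 (one_mem N) x hx b hb

theorem map_nonneg (h : IsCondExp M N E) {x : Op H} (hx : x ∈ M) (h0 : 0 ≤ x) : 0 ≤ E x := by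
  rw [ContinuousLinearMap.nonneg_iff_isPositive] at h0 ⊢
  exact h.pos' x hx h0

theorem map_mono (h : IsCondExp M N E) {x y : Op H} (hx : x ∈ M) (hy : y ∈ M) (hxy : x ≤ y) :
    E x ≤ E y := by
  rw [← sub_nonneg, ← h.map_sub hy hx]
  exact h.map_nonneg (sub_mem hy hx) (sub_nonneg.2 hxy)

theorem norm_map_mul_star_le (h : IsCondExp M N E) {u : Op H} (hu : u ∈ M) :
    ‖E (u * star u)‖ ≤ ‖u‖ ^ 2 := by
  have hm : u * star u ∈ M := mul_mem hu (star_mem hu)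
  have h0 : 0 ≤ u * star u := mul_star_self_nonneg u
  have h1 : u * star u ≤ ((‖u‖ ^ 2 : ℝ) : ℂ) • (1 : Op H) := by
    have := IsSelfAdjoint.le_algebraMap_norm_self (a := u * star u) (IsSelfAdjoint.mul_star_self u)
    rwa [CStarRing.norm_self_mul_star, ← sq, Algebra.algebraMap_eq_smul_one,
      ← Complex.coe_smul] at this
  have h2 := h.map_mono hm (smul_mem_vna M _ (one_mem M)) h1
  rw [h.map_smul' _ _ (one_mem M), h.fix' 1 (one_mem N)] at h2
  have h3 := CStarAlgebra.norm_le_norm_of_nonneg_of_le (h.map_nonneg hm h0) h2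
  refine h3.trans ?_
  rw [norm_smul, Complex.norm_real, Real.norm_of_nonneg (by positivity)]
  exact mul_le_of_le_one_right (by positivity) (ContinuousLinearMap.norm_id_le (𝕜 := ℂ) (E := H))

theorem isPLF_comp (h : IsCondExp M N E) {ψ : Op H → ℂ} (hψ : IsPLF N ψ) :
    IsPLF M (fun x => ψ (E x)) where
  map_add x hx y hy := by
    simp only [h.map_add' x hx y hy]; exact hψ.map_add _ (h.mem' x hx) _ (h.mem' y hy)
  map_smul c x hx := by
    simp only [h.map_smul' c x hx]; exact hψ.map_smul c _ (h.mem' x hx)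
  pos x hx := hψ.nonneg (h.mem' _ (mul_mem (star_mem hx) hx))
    (h.map_nonneg (mul_mem (star_mem hx) hx) (star_mul_self_nonneg x))

theorem isNormalPLF_comp (h : IsCondExp M N E) {ψ : Op H → ℂ} (hψ : IsNormalPLF N ψ) :
    IsNormalPLF M (fun x => ψ (E x)) := by
  have hP := hψ.toIsPLF
  refine { h.isPLF_comp hP with normal := fun ι p q hp hq hpq hs => ?_ }
  have h1 : (((ψ 1).re : ℝ) : ℂ) = ψ 1 := by simpa using hP.ofReal_re (one_mem N)
  rcases eq_or_ne (ψ 1) 0 with h0 | h0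
  · have hz : ∀ x ∈ M, ψ (E x) = 0 := fun x hx => by
      have := hP.norm_le (h.mem' x hx)
      rw [h0] at this
      simpa using this
    simp only [hz _ (hp _).1, hz _ hq.1]
    exact hasSum_zero
  · have hr : (ψ 1).re ≠ 0 := fun hr => h0 (by rw [← h1, hr, Complex.ofReal_zero])
    have hi : (0 : ℂ) ≤ (ψ 1)⁻¹ := by
      rw [← h1, ← Complex.ofReal_inv]
      exact_mod_cast inv_nonneg.2 hP.one_nonneg
    have hρ : IsNormalState N (fun x => (ψ 1)⁻¹ * ψ x) :=
      ⟨{ map_add := fun x hx y hy => by rw [hP.map_add x hx y hy, mul_add]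
         map_smul := fun c x hx => by rw [hP.map_smul c x hx]; ring
         pos := fun x hx => mul_nonneg hi (hP.pos x hx)
         normal := fun ι p q hp hq hpq hs => (hψ.normal ι p q hp hq hpq hs).mul_left _ },
        inv_mul_cancel₀ h0⟩
    have := ((h.normal' _ hρ).1.normal ι p q hp hq hpq hs).mul_left (ψ 1)
    simpa only [mul_inv_cancel_left₀ h0] using this

end IsCondExp

namespace IsSliceExpectation

variable {M N P : VonNeumannAlgebra H} {φP : Op H → ℂ} {E : Op H → Op H}

theorem map_of_mem (hE : IsSliceExpectation M N P φP E) {y : Op H} (hy : y ∈ P) :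
    E y = φP y • (1 : Op H) := by simpa using hE.2 1 (one_mem N) y hy

/-- The operator valued Cauchy-Schwarz inequality for a slice expectation. -/
theorem mul_star_le (hE : IsSliceExpectation M N P φP E) (hdec : IsTensorDecomposition M N P)
    (hφ : IsFNState P φP) {u y : Op H} (hu : u ∈ M) (hy : y ∈ P) :
    E (u * y) * star (E (u * y)) ≤ ((φP (star y * y)).re : ℂ) • E (u * star u) := by
  have hφP : IsPLF P φP := hφ.1.1.toIsPLF
  have hC := hE.1
  have hyM : y ∈ M := hdec.subP hy
  have huy : u * y ∈ M := mul_mem hu hyM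
  have huu : u * star u ∈ M := mul_mem hu (star_mem hu)
  set r : ℝ := (φP (star y * y)).re with hr
  have hrφ : (r : ℂ) = φP (star y * y) := hφP.ofReal_re hy
  have hr0 : 0 ≤ r := hφP.re_nonneg hy
  set b := E (u * y) with hb
  have hbN : b ∈ N := hC.mem' _ huy
  have hbM : b ∈ M := hC.subset' hbN
  have hsbN : star b ∈ N := star_mem hbN
  have hsbM : star b ∈ M := star_mem hbM
  have hbs : star b = E (star y * star u) := by rw [hb, ← hC.map_star' _ huy, star_mul]
  rcases hr0.eq_or_lt with h0 | h0
  · have hy0 : y = 0 := hφ.2 y hy (by rw [← hrφ, ← h0, Complex.ofReal_zero])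
    have : b = 0 := by rw [hb, hy0, mul_zero, hC.map_zero]
    rw [this, zero_mul, ← h0]; simp
  set t : ℂ := ((r⁻¹ : ℝ) : ℂ) with ht
  have htr : t * (r : ℂ) = 1 := by
    rw [ht, ← Complex.ofReal_mul, inv_mul_cancel₀ h0.ne', Complex.ofReal_one]
  set z : Op H := star u - t • (y * star b) with hz
  have hzM : z ∈ M := sub_mem (star_mem hu) (smul_mem_vna M _ (mul_mem hyM hsbM))
  have hpos : 0 ≤ E (star z * z) :=
    hC.map_nonneg (mul_mem (star_mem hzM) hzM) (star_mul_self_nonneg z)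
  have hsyy : star y * y ∈ P := mul_mem (star_mem hy) hy
  have e1 : star z * z = u * star u - t • (u * y * star b) - t • (b * (star y * star u))
      + t • t • (b * (star y * y) * star b) := by
    have : star t = t := by rw [ht, Complex.star_def, Complex.conj_ofReal]
    simp only [hz, star_sub, star_star, star_smul, star_mul, this, sub_mul, mul_sub,
      smul_mul_assoc, mul_smul_comm, smul_sub, mul_assoc]
    abel
  have m1 : u * y * star b ∈ M := mul_mem huy hsbM
  have m2 : star y * star u ∈ M := mul_mem (star_mem hyM) (star_mem hu)
  have m3 : b * (star y * y) * star b ∈ M := mul_mem (mul_mem hbM (hdec.subP hsyy)) hsbM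
  have e2 : E (star z * z) = E (u * star u) - t • (b * star b) := by
    rw [e1, hC.map_add' _ (sub_mem (sub_mem huu (smul_mem_vna M _ m1))
        (smul_mem_vna M _ (mul_mem hbM m2))) _ (smul_mem_vna M _ (smul_mem_vna M _ m3)),
      hC.map_sub (sub_mem huu (smul_mem_vna M _ m1)) (smul_mem_vna M _ (mul_mem hbM m2)),
      hC.map_sub huu (smul_mem_vna M _ m1), hC.map_smul' _ _ m1,
      hC.map_smul' _ _ (mul_mem hbM m2), hC.map_smul' _ _ (smul_mem_vna M _ m3),
      hC.map_smul' _ _ m3, hC.map_mul_right huy hsbN, hC.map_mul_left hbN m2, ← hbs, ← hb,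
      hC.bimod' b hbN _ (hdec.subP hsyy) _ hsbN, hE.map_of_mem hsyy, ← hrφ]
    simp only [mul_smul_comm, smul_mul_assoc, mul_one, smul_smul, htr]
    abel
  rw [e2] at hpos
  have h3 := smul_nonneg (a := (r : ℂ)) (by exact_mod_cast hr0) hpos
  rwa [smul_sub, smul_smul, mul_comm, htr, one_smul, sub_nonneg] at h3

theorem norm_sq_le (hE : IsSliceExpectation M N P φP E) (hdec : IsTensorDecomposition M N P)
    (hφ : IsFNState P φP) {u y : Op H} (hu : u ∈ M) (hy : y ∈ P) :
    ‖E (u * y)‖ ^ 2 ≤ (φP (star y * y)).re * ‖u‖ ^ 2 := by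
  have h := CStarAlgebra.norm_le_norm_of_nonneg_of_le
    (mul_star_self_nonneg (E (u * y))) (hE.mul_star_le hdec hφ hu hy)
  have hr0 : 0 ≤ (φP (star y * y)).re := hφ.1.1.toIsPLF.re_nonneg hy
  rw [CStarRing.norm_self_mul_star, ← sq, norm_smul, Complex.norm_real,
    Real.norm_of_nonneg hr0] at h
  exact h.trans (mul_le_mul_of_nonneg_left (hE.1.norm_map_mul_star_le hu) hr0)

theorem norm_sq_le' (hE : IsSliceExpectation M N P φP E) (hdec : IsTensorDecomposition M N P)
    (hφ : IsFNState P φP) {u y : Op H} (hu : u ∈ M) (hy : y ∈ P) :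
    ‖E (y * u)‖ ^ 2 ≤ (φP (y * star y)).re * ‖u‖ ^ 2 := by
  have h := hE.norm_sq_le hdec hφ (star_mem hu) (star_mem hy)
  rwa [← star_mul, hE.1.map_star' _ (mul_mem (hdec.subP hy) hu), norm_star, norm_star,
    star_star] at h

end IsSliceExpectation

/-! ### The symmetrized `L²`-space of a state -/

/-- A Hilbert completion of `P` for the inner product `φ(x* y) + φ(y x*)`, with the positive
contraction `R` representing the form `φ(x* y)`. -/
structure SymmModel (P : VonNeumannAlgebra H) (φ : Op H → ℂ) (K : Type) [NormedAddCommGroup K]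
    [InnerProductSpace ℂ K] where
  j : P.toStarSubalgebra →ₗ[ℂ] K
  dense : DenseRange j
  R : K →L[ℂ] K
  inner_R : ∀ x y, (inner ℂ (j x) (R (j y)) : ℂ) = φ (star (x : Op H) * y)
  inner_sub_R : ∀ x y, (inner ℂ (j x) (j y - R (j y)) : ℂ) = φ ((y : Op H) * star (x : Op H))
  R_symm : ∀ k l, (inner ℂ (R k) l : ℂ) = inner ℂ k (R l)
  R_nonneg : ∀ k, 0 ≤ (inner ℂ k (R k) : ℂ).re
  R_le : ∀ k, (inner ℂ k (R k) : ℂ).re ≤ ‖k‖ ^ 2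

theorem IsPLF.exists_symmModel {P : VonNeumannAlgebra H} {φ : Op H → ℂ} (h : IsPLF P φ) :
    ∃ (K : Type) (_ : NormedAddCommGroup K) (_ : InnerProductSpace ℂ K) (_ : CompleteSpace K),
      Nonempty (SymmModel P φ K) := by
  have hex : ∃ (K : Type) (_ : NormedAddCommGroup K) (_ : InnerProductSpace ℂ K)
      (_ : CompleteSpace K) (j : P.toStarSubalgebra →ₗ[ℂ] K), DenseRange j ∧
        ∀ x y, inner ℂ (j x) (j y) =
          φ (star (x : Op H) * y) + φ ((y : Op H) * star (x : Op H)) := by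
    apply exists_hilbert_of_form
    · rintro ⟨x, hx⟩ ⟨y, hy⟩ ⟨z, hz⟩
      simp only [AddMemClass.mk_add_mk, mul_add, add_mul]
      rw [h.map_add _ (mul_mem (star_mem hx) hy) _ (mul_mem (star_mem hx) hz),
        h.map_add _ (mul_mem hy (star_mem hx)) _ (mul_mem hz (star_mem hx))]
      ring
    · rintro c ⟨x, hx⟩ ⟨y, hy⟩
      simp only [SetLike.mk_smul_mk, mul_smul_comm, smul_mul_assoc]
      rw [h.map_smul _ _ (mul_mem (star_mem hx) hy), h.map_smul _ _ (mul_mem hy (star_mem hx)),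
        mul_add]
    · rintro ⟨x, hx⟩ ⟨y, hy⟩
      have h2 := h.conj_star_mul (star_mem hy) (star_mem hx)
      simp only [star_star] at h2
      rw [_root_.map_add, h.conj_star_mul hx hy, h2]
    · rintro ⟨x, hx⟩
      have := (Complex.le_def.1 (h.pos _ (star_mem hx))).1
      rw [star_star] at this
      rw [Complex.add_re]
      exact add_nonneg (h.re_nonneg hx) this
  obtain ⟨K, i1, i2, i3, j, hj, hjj⟩ := hex
  obtain ⟨K', i1', i2', i3', j', hj', hjj'⟩ := h.gns_left
  have hb : ∀ x, ‖j' x‖ ≤ 1 * ‖j x‖ := fun x => by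
    rw [one_mul]
    refine le_of_sq_le_sq ?_ (norm_nonneg _)
    rw [← inner_self_eq_norm_sq (𝕜 := ℂ) (j' x), ← inner_self_eq_norm_sq (𝕜 := ℂ) (j x), hjj, hjj',
      _root_.map_add]
    have := (Complex.le_def.1 (h.pos _ (star_mem x.2))).1
    rw [star_star] at this
    exact le_add_of_nonneg_right this
  let L : K →L[ℂ] K' := j'.extendOfNorm j
  have hL : ∀ x, L (j x) = j' x := LinearMap.extendOfNorm_eq hj ⟨1, hb⟩
  have hL1 : ∀ k, ‖L k‖ ≤ 1 * ‖k‖ := LinearMap.norm_extendOfNorm_apply_le hj 1 hb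
  have hR : ∀ k l, (inner ℂ k ((L.adjoint.comp L) l) : ℂ) = inner ℂ (L k) (L l) := fun k l => by
    rw [ContinuousLinearMap.comp_apply, ContinuousLinearMap.adjoint_inner_right]
  have hself : ∀ k, (inner ℂ k ((L.adjoint.comp L) k) : ℂ).re = ‖L k‖ ^ 2 := fun k => by
    rw [hR]; exact inner_self_eq_norm_sq (𝕜 := ℂ) _
  refine ⟨K, i1, i2, i3, ⟨{
    j := j
    dense := hj
    R := L.adjoint.comp L
    inner_R := fun x y => by rw [hR, hL, hL, hjj']
    inner_sub_R := fun x y => by rw [inner_sub_right, hR, hL, hL, hjj', hjj, add_sub_cancel_left]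
    R_symm := fun k l => by
      rw [hR, ContinuousLinearMap.comp_apply, ContinuousLinearMap.adjoint_inner_left]
    R_nonneg := fun k => by rw [hself]; positivity
    R_le := fun k => by
      rw [hself]
      have := hL1 k
      rw [one_mul] at this
      gcongr }⟩⟩

theorem IsPLF.continuous_comp {N : VonNeumannAlgebra H} {ψ : Op H → ℂ} (h : IsPLF N ψ) {X : Type}
    [TopologicalSpace X] {f : X → Op H} (hf : Continuous f) (hN : ∀ x, f x ∈ N) :
    Continuous fun x => ψ (f x) := by
  have hL : LipschitzWith (ψ 1).re.toNNReal (fun x : N => ψ (x : Op H)) :=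
    LipschitzWith.of_dist_le_mul fun x y => by
      rw [dist_eq_norm, Subtype.dist_eq, dist_eq_norm, ← h.map_sub x.2 y.2,
        Real.coe_toNNReal _ h.one_nonneg]
      exact h.norm_le (sub_mem x.2 y.2)
  exact hL.continuous.comp (hf.subtype_mk hN)

namespace SymmModel

variable {M N P : VonNeumannAlgebra H} {φ : Op H → ℂ} {E : Op H → Op H} {K : Type}
    [NormedAddCommGroup K] [InnerProductSpace ℂ K] (S : SymmModel P φ K)

theorem re_star_mul_le (y : P.toStarSubalgebra) : (φ (star (y : Op H) * y)).re ≤ ‖S.j y‖ ^ 2 := by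
  rw [← S.inner_R]
  exact S.R_le _

theorem re_mul_star_le (y : P.toStarSubalgebra) : (φ ((y : Op H) * star (y : Op H))).re ≤ ‖S.j y‖ ^ 2 := by
  rw [← S.inner_sub_R, inner_sub_right, Complex.sub_re]
  have h : (inner ℂ (S.j y) (S.j y) : ℂ).re = ‖S.j y‖ ^ 2 := inner_self_eq_norm_sq (𝕜 := ℂ) _
  rw [h]
  linarith [S.R_nonneg (S.j y)]

theorem mem_of_dense {b : K →L[ℂ] Op H} (h : ∀ y, b (S.j y) ∈ N) (k : K) : b k ∈ N :=
  S.dense.induction_on (p := fun k => b k ∈ N) k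
    ((isClosed_vna N).preimage b.continuous) h

/-- The map `y ↦ E (u y)` extends to the symmetrized `L²`-space. -/
theorem exists_slice_right (hdec : IsTensorDecomposition M N P)
    (hE : IsSliceExpectation M N P φ E) (hφ : IsFNState P φ) {u : Op H} (hu : u ∈ M) :
    ∃ b : K →L[ℂ] Op H, (∀ y, b (S.j y) = E (u * y)) ∧ ∀ k, b k ∈ N := by
  have hM : ∀ y : P.toStarSubalgebra, u * (y : Op H) ∈ M := fun y => mul_mem hu (hdec.subP y.2)
  let f : P.toStarSubalgebra →ₗ[ℂ] Op H :=
    { toFun := fun y => E (u * y)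
      map_add' := fun x y => by
        rw [AddMemClass.coe_add, mul_add, hE.1.map_add' _ (hM x) _ (hM y)]
      map_smul' := fun c x => by
        rw [SetLike.val_smul, mul_smul_comm, hE.1.map_smul' _ _ (hM x), RingHom.id_apply] }
  have hf : ∀ y, ‖f y‖ ≤ ‖u‖ * ‖S.j y‖ := fun y => by
    refine le_of_sq_le_sq ?_ (by positivity)
    refine (hE.norm_sq_le hdec hφ hu y.2).trans ?_
    rw [mul_pow, mul_comm]
    gcongr
    exact S.re_star_mul_le y
  have hb : ∀ y, f.extendOfNorm S.j (S.j y) = E (u * y) :=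
    LinearMap.extendOfNorm_eq S.dense ⟨_, hf⟩
  refine ⟨f.extendOfNorm S.j, hb, S.mem_of_dense fun y => ?_⟩
  rw [hb]
  exact hE.1.mem' _ (hM y)

/-- The map `y ↦ E (y u)` extends to the symmetrized `L²`-space. -/
theorem exists_slice_left (hdec : IsTensorDecomposition M N P)
    (hE : IsSliceExpectation M N P φ E) (hφ : IsFNState P φ) {u : Op H} (hu : u ∈ M) :
    ∃ a : K →L[ℂ] Op H, (∀ y, a (S.j y) = E (y * u)) ∧ ∀ k, a k ∈ N := by
  have hM : ∀ y : P.toStarSubalgebra, (y : Op H) * u ∈ M := fun y => mul_mem (hdec.subP y.2) hu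
  let f : P.toStarSubalgebra →ₗ[ℂ] Op H :=
    { toFun := fun y => E (y * u)
      map_add' := fun x y => by
        rw [AddMemClass.coe_add, add_mul, hE.1.map_add' _ (hM x) _ (hM y)]
      map_smul' := fun c x => by
        rw [SetLike.val_smul, smul_mul_assoc, hE.1.map_smul' _ _ (hM x), RingHom.id_apply] }
  have hf : ∀ y, ‖f y‖ ≤ ‖u‖ * ‖S.j y‖ := fun y => by
    refine le_of_sq_le_sq ?_ (by positivity)
    refine (hE.norm_sq_le' hdec hφ hu y.2).trans ?_
    rw [mul_pow, mul_comm]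
    gcongr
    exact S.re_mul_star_le y
  have hb : ∀ y, f.extendOfNorm S.j (S.j y) = E (y * u) :=
    LinearMap.extendOfNorm_eq S.dense ⟨_, hf⟩
  refine ⟨f.extendOfNorm S.j, hb, S.mem_of_dense fun y => ?_⟩
  rw [hb]
  exact hE.1.mem' _ (hM y)

/-- Passing an intertwiner of `ψ' ∘ E` and `ψ ∘ E` through its two families of slices. -/
theorem apply_mul_slice (hdec : IsTensorDecomposition M N P)
    (hE : IsSliceExpectation M N P φ E) {ψ ψ' : Op H → ℂ} (hψ : IsPLF N ψ) (hψ' : IsPLF N ψ')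
    {u : Op H} (hu : u ∈ M) {l : ℝ}
    (hrel : ∀ z ∈ M, ψ' (E (z * u)) = l * ψ (E (u * z)))
    {a b : K →L[ℂ] Op H} (ha : ∀ y, a (S.j y) = E (y * u)) (haN : ∀ k, a k ∈ N)
    (hb : ∀ y, b (S.j y) = E (u * y)) (hbN : ∀ k, b k ∈ N) {x : Op H} (hx : x ∈ N) (k : K) :
    ψ' (x * a k) = l * ψ (b k * x) := by
  refine S.dense.induction_on (p := fun k => ψ' (x * a k) = l * ψ (b k * x)) k
    (isClosed_eq ?_ ?_) fun y => ?_
  · exact hψ'.continuous_comp (by fun_prop) fun k => mul_mem hx (haN k)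
  · exact continuous_const.mul (hψ.continuous_comp (by fun_prop) fun k => mul_mem (hbN k) hx)
  · have hy := hdec.subP y.2
    rw [ha, hb, ← hE.1.map_mul_left hx (mul_mem hy hu), ← hE.1.map_mul_right (mul_mem hu hy) hx,
      mul_assoc u, ← hdec.comm x hx y y.2, ← mul_assoc x]
    exact hrel _ (mul_mem (hdec.subN hx) hy)

/-- The two families of slices of an element of `M` determine each other. -/
theorem slice_left_R (hdec : IsTensorDecomposition M N P)
    (hE : IsSliceExpectation M N P φ E) {φN φM : Op H → ℂ} (hφN : IsFNState N φN)
    (hφM : IsFNState M φM)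
    (hprod : ∀ x ∈ N, ∀ y ∈ P, φM (x * y) = φN x * φ y) (hEφ : ∀ x ∈ M, φM (E x) = φM x)
    {u : Op H} (hu : u ∈ M)
    {a b : K →L[ℂ] Op H} (ha : ∀ y, a (S.j y) = E (y * u)) (haN : ∀ k, a k ∈ N)
    (hb : ∀ y, b (S.j y) = E (u * y)) (hbN : ∀ k, b k ∈ N) (k : K) :
    a (S.R k) = b (k - S.R k) := by
  obtain ⟨ι, ζ, hζ⟩ := hφM.1.1.exists_hilbertSum
  have hM := hφM.1.1.toIsPLF
  have hinner : ∀ x ∈ M, ∀ y ∈ M, φM (star x * y) = inner ℂ (ampl x ζ) (ampl y ζ) :=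
    fun x hx y hy => by rw [hζ _ (mul_mem (star_mem hx) hy), inner_ampl_star_mul]
  have key : ∀ n ∈ N, φM (n * a (S.R k)) = φM (n * b (k - S.R k)) := by
    intro n hn
    have hnM := hdec.subN hn
    have hPM : ∀ y : P.toStarSubalgebra, (y : Op H) ∈ M := fun y => hdec.subP y.2
    let f : P.toStarSubalgebra →ₛₗ[starRingEnd ℂ] HilbertSum ι H :=
      { toFun := fun y => ampl (star (n * (y : Op H))) ζ
        map_add' := fun x y => by
          rw [AddMemClass.coe_add, mul_add, star_add, ampl_add]
        map_smul' := fun c x => by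
          rw [SetLike.val_smul, mul_smul_comm, star_smul, ampl_smul]; rfl }
    have hf : ∀ y, ‖f y‖ ≤ √(φN (n * star n)).re * ‖S.j y‖ := fun y => by
      have hpos : 0 ≤ (φN (n * star n)).re := by
        simpa using hφN.1.1.toIsPLF.re_nonneg (star_mem hn)
      refine le_of_sq_le_sq ?_ (by positivity)
      have h1 : ((‖f y‖ ^ 2 : ℝ) : ℂ) = φN (n * star n) * φ (y * star (y : Op H)) := by
        rw [← hprod _ (mul_mem hn (star_mem hn)) _ (mul_mem y.2 (star_mem y.2)), Complex.ofReal_pow,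
          ← RCLike.ofReal_eq_complex_ofReal, ← inner_self_eq_norm_sq_to_K (𝕜 := ℂ)]
        change inner ℂ (ampl (star (n * (y : Op H))) ζ) (ampl (star (n * (y : Op H))) ζ) = _
        rw [← hinner _ (star_mem (mul_mem hnM (hPM y))) _ (star_mem (mul_mem hnM (hPM y)))]
        congr 1
        have := hdec.comm _ (star_mem hn) _ (mul_mem y.2 (star_mem y.2))
        rw [star_star, star_mul, mul_assoc, mul_assoc n, ← mul_assoc _ (star (y : Op H)), ← this]
      have h2 := hφN.1.1.toIsPLF.ofReal_re (star_mem hn)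
      rw [star_star] at h2
      rw [← h2] at h1
      have h3 := congrArg Complex.re h1
      rw [Complex.ofReal_re, Complex.re_ofReal_mul] at h3
      rw [h3, mul_pow, Real.sq_sqrt hpos]
      exact mul_le_mul_of_nonneg_left (S.re_mul_star_le y) hpos
    let g : P.toStarSubalgebra →ₗ[ℂ] HilbertSum ι H :=
      { toFun := fun y => ampl y ζ
        map_add' := fun x y => by rw [AddMemClass.coe_add, ampl_add]
        map_smul' := fun c x => by rw [SetLike.val_smul, ampl_smul]; rfl }
    have hg : ∀ y, ‖g y‖ ≤ 1 * ‖S.j y‖ := fun y => by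
      refine le_of_sq_le_sq ?_ (by positivity)
      rw [one_mul]
      refine le_trans (le_of_eq ?_) (S.re_star_mul_le y)
      rw [← inner_self_eq_norm_sq (𝕜 := ℂ)]
      change (inner ℂ (ampl y ζ) (ampl y ζ)).re = _
      rw [← hinner _ (hPM y) _ (hPM y)]
      have := hprod 1 (one_mem N) _ (mul_mem (star_mem y.2) y.2)
      rw [one_mul, hφN.1.2, one_mul] at this
      rw [this]
    let η := f.extendOfNorm S.j
    let θ := g.extendOfNorm S.j
    have hη : ∀ y, η (S.j y) = ampl (star (n * (y : Op H))) ζ := LinearMap.extendOfNorm_eq S.dense ⟨_, hf⟩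
    have hθ : ∀ y, θ (S.j y) = ampl y ζ := LinearMap.extendOfNorm_eq S.dense ⟨_, hg⟩
    have hA : ∀ k, φM (n * a k) = inner ℂ (η k) (ampl u ζ) := fun k =>
      S.dense.induction_on (p := fun k => φM (n * a k) = inner ℂ (η k) (ampl u ζ)) k
        (isClosed_eq (hM.continuous_comp (by fun_prop) fun k => mul_mem hnM (hdec.subN (haN k)))
          (by fun_prop)) fun y => by
        rw [ha, hη, ← hinner _ (star_mem (mul_mem hnM (hPM y))) _ hu, star_star, mul_assoc,
          ← hE.1.map_mul_left hn (mul_mem (hPM y) hu), hEφ _ (mul_mem hnM (mul_mem (hPM y) hu))]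
    have hB : ∀ k, φM (n * b k) = inner ℂ (ampl (star n) ζ) (ampl u (θ k)) := fun k =>
      S.dense.induction_on
        (p := fun k => φM (n * b k) = inner ℂ (ampl (star n) ζ) (ampl u (θ k))) k
        (isClosed_eq (hM.continuous_comp (by fun_prop) fun k => mul_mem hnM (hdec.subN (hbN k)))
          (by fun_prop)) fun y => by
        rw [hb, hθ, ← ampl_mul, ← hinner _ (star_mem hnM) _ (mul_mem hu (hPM y)), star_star,
          ← hE.1.map_mul_left hn (mul_mem hu (hPM y)), hEφ _ (mul_mem hnM (mul_mem hu (hPM y)))]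
    have hC : ∀ n' ∈ N, ∀ p : P.toStarSubalgebra, ∀ k,
        inner ℂ (η k) (ampl (n' * (p : Op H)) ζ) = φN (n * n') * inner ℂ (S.j (star p)) (k - S.R k) :=
      fun n' hn' p k => S.dense.induction_on (p := fun k => inner ℂ (η k) (ampl (n' * (p : Op H)) ζ)
          = φN (n * n') * inner ℂ (S.j (star p)) (k - S.R k)) k
        (isClosed_eq (by fun_prop) (by fun_prop)) fun y => by
        rw [hη, S.inner_sub_R, ← hinner _ (star_mem (mul_mem hnM (hPM y))) _
          (mul_mem (hdec.subN hn') (hPM p)), star_star, StarMemClass.coe_star, star_star,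
          ← hprod _ (mul_mem hn hn') _ (mul_mem y.2 p.2), mul_assoc, ← mul_assoc _ n',
          ← hdec.comm n' hn' y y.2]
        simp only [mul_assoc]
    have hD : ∀ n' ∈ N, ∀ p : P.toStarSubalgebra, ∀ k,
        inner ℂ (ampl (star n) ζ) (ampl (n' * (p : Op H)) (θ k))
          = φN (n * n') * inner ℂ (S.j (star p)) (S.R k) :=
      fun n' hn' p k => S.dense.induction_on
        (p := fun k => inner ℂ (ampl (star n) ζ) (ampl (n' * (p : Op H)) (θ k))
          = φN (n * n') * inner ℂ (S.j (star p)) (S.R k)) k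
        (isClosed_eq (by fun_prop) (by fun_prop)) fun y => by
        rw [hθ, S.inner_R, ← ampl_mul, ← hinner _ (star_mem hnM) _
          (mul_mem (mul_mem (hdec.subN hn') (hPM p)) (hPM y)), star_star, StarMemClass.coe_star,
          star_star, ← hprod _ (mul_mem hn hn') _ (mul_mem p.2 y.2)]
        simp only [mul_assoc]
    rw [hA, hB]
    refine inner_ampl_eq hdec _ _ _ _ (fun z hz => ?_) hu
    refine Submodule.span_induction (p := fun z _ => (inner ℂ (η (S.R k)) (ampl z ζ) : ℂ)
      = inner ℂ (ampl (star n) ζ) (ampl z (θ (k - S.R k)))) ?_ ?_ ?_ ?_ hz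
    · rintro _ ⟨x, hx, y, hy, rfl⟩
      rw [hC x hx ⟨y, hy⟩, hD x hx ⟨y, hy⟩, _root_.map_sub]
    · have h0 : ∀ w : HilbertSum ι H, ampl (0 : Op H) w = 0 := fun w => by
        simpa using ampl_smul (0 : ℂ) (0 : Op H) w
      rw [h0, h0, inner_zero_right, inner_zero_right]
    · intro x y _ _ h1 h2
      rw [ampl_add, ampl_add, inner_add_right, inner_add_right, h1, h2]
    · intro c x _ h1
      rw [ampl_smul, ampl_smul, inner_smul_right, inner_smul_right, h1]
  have hd : a (S.R k) - b (k - S.R k) ∈ N := sub_mem (haN _) (hbN _)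
  rw [← sub_eq_zero]
  refine hφM.2 _ (hdec.subN hd) ?_
  rw [mul_sub, hM.map_sub (hdec.subN (mul_mem (star_mem hd) (haN _)))
    (hdec.subN (mul_mem (star_mem hd) (hbN _))), key _ (star_mem hd), sub_self]

end SymmModel

theorem IsTensorDecomposition.exists_finiteDimensional_slice {M N P : VonNeumannAlgebra H}
    {φ : Op H → ℂ} {E : Op H → Op H} (hdec : IsTensorDecomposition M N P)
    (hE : IsSliceExpectation M N P φ E) {a : Op H} (ha : a ∈ tensorSpan N P) :
    ∃ F : Submodule ℂ (Op H), FiniteDimensional ℂ F ∧ ∀ y ∈ P, E (star a * y) ∈ F := by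
  have hM : ∀ z ∈ tensorSpan N P, ∀ y ∈ P, star z * y ∈ M := fun z hz y hy =>
    mul_mem (star_mem (tensorSpan_le hdec hz)) (hdec.subP hy)
  refine Submodule.span_induction (p := fun z _ => ∃ F : Submodule ℂ (Op H),
    FiniteDimensional ℂ F ∧ ∀ y ∈ P, E (star z * y) ∈ F) ?_ ?_ ?_ ?_ ha
  · rintro _ ⟨n, hn, p, hp, rfl⟩
    refine ⟨Submodule.span ℂ {star n}, inferInstance, fun y hy => ?_⟩
    rw [hdec.comm n hn p hp, star_mul, mul_assoc, hE.2 _ (star_mem hn) _ (mul_mem (star_mem hp) hy)]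
    exact Submodule.smul_mem _ _ (Submodule.mem_span_singleton_self _)
  · refine ⟨⊥, inferInstance, fun y hy => ?_⟩
    rw [star_zero, zero_mul, hE.1.map_zero]
    exact zero_mem _
  · rintro x y hx hy ⟨F, hF, h1⟩ ⟨F', hF', h2⟩
    refine ⟨F ⊔ F', inferInstance, fun z hz => ?_⟩
    rw [star_add, add_mul, hE.1.map_add' _ (hM x hx z hz) _ (hM y hy z hz)]
    exact add_mem (Submodule.mem_sup_left (h1 z hz)) (Submodule.mem_sup_right (h2 z hz))
  · rintro c x hx ⟨F, hF, h1⟩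
    refine ⟨F, hF, fun z hz => ?_⟩
    rw [star_smul, smul_mul_assoc, hE.1.map_smul' _ _ (hM x hx z hz)]
    exact F.smul_mem _ (h1 z hz)

theorem finiteDimensional_comap_of_injective {V W : Type} [AddCommGroup V] [Module ℂ V]
    [AddCommGroup W] [Module ℂ W] {f : V →ₗ[ℂ] W} (hf : Function.Injective f)
    (F : Submodule ℂ W) [FiniteDimensional ℂ F] : FiniteDimensional ℂ (F.comap f) :=
  Module.Finite.of_injective (f.restrict (p := F.comap f) (q := F) fun _ h => h)
    fun _ _ h => Subtype.ext (hf (congrArg Subtype.val h))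

theorem isCompactOperator_of_range_le {K L : Type} [NormedAddCommGroup K] [NormedSpace ℂ K]
    [NormedAddCommGroup L] [NormedSpace ℂ L] (V : K →L[ℂ] L) (F : Submodule ℂ L)
    [FiniteDimensional ℂ F] (h : ∀ k, V k ∈ F) : IsCompactOperator V := by
  have h1 : IsCompactOperator (F.subtypeL) := by
    have : ProperSpace F := FiniteDimensional.proper ℂ F
    have hid : IsCompactOperator (id : F → F) :=
      ⟨Metric.closedBall 0 1, isCompact_closedBall _ _, Metric.closedBall_mem_nhds _ one_pos⟩
    exact hid.clm_comp F.subtypeL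
  exact h1.comp_clm (V.codRestrict F h)

namespace SymmModel

variable {M N P : VonNeumannAlgebra H} {φ ψ : Op H → ℂ} {E : Op H → Op H} {K L : Type}
    [NormedAddCommGroup K] [InnerProductSpace ℂ K] (S : SymmModel P φ K)
    [NormedAddCommGroup L] [InnerProductSpace ℂ L] [CompleteSpace L]
    {J : N.toStarSubalgebra →ₗ[ℂ] L}

theorem exists_gns_slice (hdec : IsTensorDecomposition M N P)
    (hE : IsSliceExpectation M N P φ E) (hφ : IsFNState P φ) (hψ : IsPLF N ψ)
    (hJ : ∀ x y, inner ℂ (J x) (J y) = ψ ((y : Op H) * star (x : Op H)))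
    {u : Op H} (hu : u ∈ M) :
    ∃ V : K →L[ℂ] L,
      (∀ y, V (S.j y) = J ⟨E (u * y), hE.1.mem' _ (mul_mem hu (hdec.subP y.2))⟩) ∧
      ‖V‖ ≤ √(ψ (E (u * star u))).re := by
  have hM : ∀ y : P.toStarSubalgebra, u * (y : Op H) ∈ M := fun y => mul_mem hu (hdec.subP y.2)
  let f : P.toStarSubalgebra →ₗ[ℂ] L :=
    { toFun := fun y => J ⟨E (u * y), hE.1.mem' _ (hM y)⟩
      map_add' := fun x y => by
        rw [← _root_.map_add]
        congr 1
        ext1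
        change E _ = E _ + E _
        rw [AddMemClass.coe_add, mul_add, hE.1.map_add' _ (hM x) _ (hM y)]
      map_smul' := fun c x => by
        rw [RingHom.id_apply, ← _root_.map_smul]
        congr 1
        ext1
        change E _ = c • E _
        rw [SetLike.val_smul, mul_smul_comm, hE.1.map_smul' _ _ (hM x)] }
  have huu : u * star u ∈ M := mul_mem hu (star_mem hu)
  have hpos : 0 ≤ (ψ (E (u * star u))).re := by
    simpa using (hE.1.isPLF_comp hψ).re_nonneg (star_mem hu)
  have hf : ∀ y, ‖f y‖ ≤ √(ψ (E (u * star u))).re * ‖S.j y‖ := fun y => by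
    refine le_of_sq_le_sq ?_ (by positivity)
    rw [mul_pow, Real.sq_sqrt hpos]
    have h1 : ‖f y‖ ^ 2 = (ψ (E (u * y) * star (E (u * y)))).re := by
      rw [← inner_self_eq_norm_sq (𝕜 := ℂ)]
      change (inner ℂ (J _) (J _)).re = _
      rw [hJ]
    have hyN := hE.1.mem' _ (hM y)
    rw [h1]
    refine (hψ.re_mono (mul_mem hyN (star_mem hyN)) (smul_mem_vna N _ (hE.1.mem' _ huu))
      (hE.mul_star_le hdec hφ hu y.2)).trans ?_
    rw [hψ.map_smul _ _ (hE.1.mem' _ huu), Complex.re_ofReal_mul, mul_comm]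
    gcongr
    exact S.re_star_mul_le y
  exact ⟨f.extendOfNorm S.j, LinearMap.extendOfNorm_eq S.dense ⟨_, hf⟩,
    ContinuousLinearMap.opNorm_le_bound _ (Real.sqrt_nonneg _)
      (LinearMap.norm_extendOfNorm_apply_le S.dense _ hf)⟩

theorem isCompactOperator_gns_slice (hdec : IsTensorDecomposition M N P)
    (hE : IsSliceExpectation M N P φ E) (hφ : IsFNState P φ) (hψ : IsNormalPLF N ψ)
    (hJ : ∀ x y, inner ℂ (J x) (J y) = ψ ((y : Op H) * star (x : Op H)))
    {u : Op H} (hu : u ∈ M) {V : K →L[ℂ] L}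
    (hV : ∀ y, V (S.j y) = J ⟨E (u * y), hE.1.mem' _ (mul_mem hu (hdec.subP y.2))⟩) :
    IsCompactOperator V := by
  obtain ⟨ι, ζ, hζ⟩ := (hE.1.isNormalPLF_comp hψ).exists_hilbertSum
  have key : ∀ ε > 0, ∃ V' : K →L[ℂ] L, IsCompactOperator V' ∧ ‖V - V'‖ < ε := by
    intro ε hε
    obtain ⟨a, ha, haε⟩ := exists_tensorSpan_norm_lt hdec (star_mem hu) ζ hε
    have haM := tensorSpan_le hdec ha
    have hsa : star a ∈ M := star_mem haM
    have hus : u - star a ∈ M := sub_mem hu hsa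
    obtain ⟨V', hV', -⟩ := S.exists_gns_slice hdec hE hφ hψ.toIsPLF hJ hsa
    obtain ⟨W, hW, hWn⟩ := S.exists_gns_slice hdec hE hφ hψ.toIsPLF hJ hus
    have hWV : V - V' = W := by
      ext k
      refine congrFun (S.dense.equalizer (V - V').continuous W.continuous (funext fun y => ?_)) k
      simp only [Function.comp_apply, sub_apply]
      rw [hV, hV', hW, ← _root_.map_sub]
      congr 1
      ext1
      change E _ - E _ = E _
      rw [sub_mul, hE.1.map_sub (mul_mem hu (hdec.subP y.2)) (mul_mem hsa (hdec.subP y.2))]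
    refine ⟨V', ?_, ?_⟩
    · obtain ⟨F, hF, hFa⟩ := hdec.exists_finiteDimensional_slice hE ha
      let i : N.toStarSubalgebra →ₗ[ℂ] Op H := N.toStarSubalgebra.subtype.toAlgHom.toLinearMap
      have : FiniteDimensional ℂ (F.comap i) :=
        finiteDimensional_comap_of_injective Subtype.val_injective F
      let F' : Submodule ℂ L := (F.comap i).map J
      have hF' : FiniteDimensional ℂ F' := inferInstance
      refine isCompactOperator_of_range_le V' F' fun k => ?_
      refine S.dense.induction_on (p := fun k => V' k ∈ F') k
        (F'.closed_of_finiteDimensional.preimage V'.continuous) fun y => ?_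
      rw [hV']
      exact Submodule.mem_map_of_mem (hFa y y.2)
    · rw [hWV]
      refine hWn.trans_lt ?_
      have h1 := hζ _ (mul_mem hus (star_mem hus))
      have h2 : u - star a = star (star u - a) := by rw [star_sub, star_star]
      rw [h1, h2, star_star, inner_ampl_star_mul]
      have h3 : (inner ℂ (ampl (star u - a) ζ) (ampl (star u - a) ζ) : ℂ).re
        = ‖ampl (star u - a) ζ‖ ^ 2 := inner_self_eq_norm_sq (𝕜 := ℂ) _
      rw [h3, Real.sqrt_sq (norm_nonneg _)]
      exact haε
  choose W hW hWn using fun n : ℕ => key (1 / (n + 1)) (by positivity)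
  refine isCompactOperator_of_tendsto (l := Filter.atTop) (F := W) ?_ (Filter.Eventually.of_forall hW)
  rw [tendsto_iff_norm_sub_tendsto_zero]
  refine squeeze_zero (fun _ => norm_nonneg _) (fun n => ?_) tendsto_one_div_add_atTop_nhds_zero_nat
  rw [norm_sub_rev]
  exact (hWn n).le

end SymmModel

/-- A symmetric operator commuting with `V* V`, for `V` compact and nonzero, shares an eigenvector
with it. -/
theorem exists_common_eigenvector {K L : Type} [NormedAddCommGroup K] [InnerProductSpace ℂ K]
    [CompleteSpace K] [NormedAddCommGroup L] [InnerProductSpace ℂ L] [CompleteSpace L]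
    {V : K →L[ℂ] L} (hV : IsCompactOperator V) (hV0 : V ≠ 0) {R : K →L[ℂ] K}
    (hR : ∀ k l, (inner ℂ (R k) l : ℂ) = inner ℂ k (R l))
    (hc : ∀ k l, (inner ℂ (V (R k)) (V l) : ℂ) = inner ℂ (V k) (V (R l))) :
    ∃ (k : K) (r : ℝ), V k ≠ 0 ∧ R k = (r : ℂ) • k := by
  let G : K →L[ℂ] K := V.adjoint.comp V
  have hG : ∀ k l, (inner ℂ k (G l) : ℂ) = inner ℂ (V k) (V l) := fun k l => by
    rw [ContinuousLinearMap.comp_apply, ContinuousLinearMap.adjoint_inner_right]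
  have hGs : G.IsSymmetric := fun k l => by
    change inner ℂ (G k) l = inner ℂ k (G l)
    rw [hG, ContinuousLinearMap.comp_apply, ContinuousLinearMap.adjoint_inner_left]
  have hGc : IsCompactOperator G := hV.clm_comp V.adjoint
  have hG0 : G ≠ 0 := fun h => hV0 <| by
    ext k
    have := hG k k
    rw [h, zero_apply, inner_zero_right, eq_comm, inner_self_eq_zero] at this
    exact this
  have hex : ∃ μ : ℂ, Module.End.HasEigenvalue (G : Module.End ℂ K) μ ∧ μ ≠ 0 := by
    by_contra! h
    exact hG0 ((ContinuousLinearMap.eq_zero_of_forall_hasEigenvalue_eq_zero hGc hGs).1 h)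
  obtain ⟨μ, hμ, hμ0⟩ := hex
  have hfin := ContinuousLinearMap.finite_dimensional_eigenspace hGc μ hμ0
  set F := Module.End.eigenspace (G : Module.End ℂ K) μ with hF
  have hinv : ∀ k ∈ F, (R : K →ₗ[ℂ] K) k ∈ F := fun k hk => by
    rw [hF, Module.End.mem_eigenspace_iff] at hk ⊢
    change G (R k) = μ • R k
    rw [← _root_.map_smul, ← show G k = μ • k from hk]
    refine ext_inner_left ℂ fun l => ?_
    rw [hG, ← hR, hG, hc]
  have hRs : (R : K →ₗ[ℂ] K).IsSymmetric := hR
  have hnt : Nontrivial F := Submodule.nontrivial_iff_ne_bot.2 hμ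
  have hev := (hRs.restrict_invariant hinv).hasEigenvalue_iSup_of_finiteDimensional
  obtain ⟨k, hk, hk0⟩ := hev.exists_hasEigenvector
  refine ⟨k, _, fun h => ?_, congrArg Subtype.val (Module.End.mem_eigenspace_iff.1 hk)⟩
  have h1 : G k = μ • (k : K) := Module.End.mem_eigenspace_iff.1 k.2
  rw [ContinuousLinearMap.comp_apply, h, _root_.map_zero, eq_comm, smul_eq_zero] at h1
  exact hk0 (Subtype.ext (h1.resolve_left hμ0))

theorem IsTensorDecomposition.apply_slice_eq_zero {M N P : VonNeumannAlgebra H}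
    {φ ψ : Op H → ℂ} {E : Op H → Op H} (hdec : IsTensorDecomposition M N P)
    (hE : IsSliceExpectation M N P φ E) (hψ : IsNormalPLF N ψ) {u : Op H} (hu : u ∈ M)
    (h0 : ∀ y ∈ P, ψ (E (u * y) * star (E (u * y))) = 0) : ψ (E (u * star u)) = 0 := by
  obtain ⟨ι, ζ, hζ⟩ := (hE.1.isNormalPLF_comp hψ).exists_hilbertSum
  have h1 : ∀ z ∈ M, ψ (E (u * z)) = inner ℂ (ampl (star u) ζ) (ampl z ζ) := fun z hz => by
    rw [hζ _ (mul_mem hu hz), ← inner_ampl_star_mul, star_star]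
  rw [h1 _ (star_mem hu)]
  refine inner_ampl_eq_zero hdec _ _ (fun a ha => ?_) (star_mem hu)
  refine Submodule.span_induction
    (p := fun a _ => (inner ℂ (ampl (star u) ζ) (ampl a ζ) : ℂ) = 0) ?_ ?_ ?_ ?_ ha
  · rintro _ ⟨n, hn, p, hp, rfl⟩
    have hup := mul_mem hu (hdec.subP hp)
    rw [← h1 _ (mul_mem (hdec.subN hn) (hdec.subP hp)), hdec.comm n hn p hp, ← mul_assoc,
      hE.1.map_mul_right hup hn]
    exact hψ.toIsPLF.eq_zero_of_left (hE.1.mem' _ hup) hn (h0 p hp)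
  · rw [← h1 _ (zero_mem M), mul_zero, hE.1.map_zero, hψ.toIsPLF.map_zero]
  · intro x y _ _ h1 h2
    rw [ampl_add, inner_add_right, h1, h2, add_zero]
  · intro c x _ h1
    rw [ampl_smul, inner_smul_right, h1, mul_zero]

/-- An intertwiner between `ψ' ∘ E` and `ψ ∘ E` in `M = N ⊗̄ P` yields one between `ψ'` and `ψ`. -/
theorem exists_intertwiner_of_slice {M N P : VonNeumannAlgebra H}
    (hdec : IsTensorDecomposition M N P) {φN φP φM : Op H → ℂ} (hφN : IsFNState N φN)
    (hφP : IsFNState P φP) (hφM : IsFNState M φM)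
    (hprod : ∀ x ∈ N, ∀ y ∈ P, φM (x * y) = φN x * φP y) {E : Op H → Op H}
    (hE : IsSliceExpectation M N P φP E) (hEφ : ∀ x ∈ M, φM (E x) = φM x)
    {ψ ψ' : Op H → ℂ} (hψ : IsNormalPLF N ψ) (hψ' : IsPLF N ψ') {v : Op H} (hv : v ∈ M) {l : ℝ}
    (hl : 0 < l) (hrel : ∀ x ∈ M, ψ' (E (v * x)) = l * ψ (E (x * v)))
    (hne : ψ (E (star v * v)) ≠ 0) :
    ∃ a ∈ N, ∃ μ : ℝ, 0 < μ ∧ ψ (star a * a) ≠ 0 ∧ ∀ x ∈ N, ψ' (a * x) = μ * ψ (x * a) := by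
  obtain ⟨K, _, _, _, ⟨S⟩⟩ := hφP.1.1.toIsPLF.exists_symmModel
  have hu : star v ∈ M := star_mem hv
  have hrel' : ∀ z ∈ M, ψ' (E (z * star v)) = l * ψ (E (star v * z)) := fun z hz => by
    have h1 := congrArg (starRingEnd ℂ) (hrel _ (star_mem hz))
    rw [map_mul, Complex.conj_ofReal, ← hψ'.conj_star (hE.1.mem' _ (mul_mem hv (star_mem hz))),
      ← hψ.conj_star (hE.1.mem' _ (mul_mem (star_mem hz) hv)),
      ← hE.1.map_star' _ (mul_mem hv (star_mem hz)),
      ← hE.1.map_star' _ (mul_mem (star_mem hz) hv), star_mul, star_mul, star_star] at h1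
    exact h1
  obtain ⟨a, ha, haN⟩ := S.exists_slice_left hdec hE hφP hu
  obtain ⟨b, hb, hbN⟩ := S.exists_slice_right hdec hE hφP hu
  have hab := S.slice_left_R hdec hE hφN hφM hprod hEφ hu ha haN hb hbN
  have h1 : ∀ x ∈ N, ∀ k, ψ' (x * a k) = l * ψ (b k * x) := fun x hx k =>
    S.apply_mul_slice hdec hE hψ.toIsPLF hψ' hu hrel' ha haN hb hbN hx k
  have h2 : ∀ x ∈ N, ∀ k, ψ' (star (a k) * x) = l * ψ (x * star (b k)) := fun x hx k => by
    have h3 := hψ.toIsPLF.conj_star_mul (star_mem hx) (star_mem (hbN k))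
    rw [star_star, star_star] at h3
    rw [← hψ'.conj_star_mul (haN k) hx, h1 _ (star_mem hx), map_mul, Complex.conj_ofReal, h3]
  obtain ⟨L, _, _, _, J, -, hJ⟩ := hψ.toIsPLF.gns_right
  obtain ⟨V, hV, -⟩ := S.exists_gns_slice hdec hE hφP hψ.toIsPLF hJ hu
  have hVV : ∀ k m, (inner ℂ (V k) (V m) : ℂ) = ψ (b m * star (b k)) := by
    refine S.dense.induction_on₂ (isClosed_eq (by fun_prop) ?_) fun x y => ?_
    · exact hψ.toIsPLF.continuous_comp (by fun_prop) fun q => mul_mem (hbN _) (star_mem (hbN _))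
    · rw [hV, hV, hJ, hb, hb]
  have hVc := S.isCompactOperator_gns_slice hdec hE hφP hψ hJ hu hV
  have hV0 : V ≠ 0 := fun h => hne <| by
    have := hdec.apply_slice_eq_zero hE hψ hu fun y hy => by
      rw [← hb ⟨y, hy⟩, ← hVV, h, zero_apply, inner_zero_left]
    rwa [star_star] at this
  have hlc : (l : ℂ) ≠ 0 := Complex.ofReal_ne_zero.2 hl.ne'
  have hcomm : ∀ k m, (inner ℂ (V (S.R k)) (V m) : ℂ) = inner ℂ (V k) (V (S.R m)) := by
    intro k m
    have h3 : (inner ℂ (V (S.R k)) (V (m - S.R m)) : ℂ)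
        = inner ℂ (V (k - S.R k)) (V (S.R m)) := by
      rw [hVV, hVV, ← hab, ← hab]
      exact mul_left_cancel₀ hlc ((h2 _ (haN _) _).symm.trans (h1 _ (star_mem (haN _)) _))
    rw [_root_.map_sub, _root_.map_sub, inner_sub_left, inner_sub_right] at h3
    exact sub_left_injective h3
  obtain ⟨k, r, hk, hRk⟩ := exists_common_eigenvector hVc hV0 S.R_symm hcomm
  have hbb : ψ (b k * star (b k)) ≠ 0 := by
    rw [← hVV]
    exact inner_self_ne_zero.2 hk
  have hk0 : 0 < ‖k‖ ^ 2 := by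
    have : k ≠ 0 := fun h => hk (by rw [h, _root_.map_zero])
    positivity
  have hkR : (inner ℂ k (S.R k) : ℂ).re = r * ‖k‖ ^ 2 := by
    have : (inner ℂ k k : ℂ).re = ‖k‖ ^ 2 := inner_self_eq_norm_sq (𝕜 := ℂ) _
    rw [hRk, inner_smul_right, Complex.re_ofReal_mul, this]
  have hr0 : 0 ≤ r := by
    have := S.R_nonneg k
    rw [hkR] at this
    exact nonneg_of_mul_nonneg_left this hk0
  have hr1 : r ≤ 1 := by
    have := S.R_le k
    rw [hkR] at this
    exact le_of_mul_le_mul_right (by rwa [one_mul]) hk0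
  have habk : (r : ℂ) • a k = (1 - r : ℂ) • b k := by
    rw [← _root_.map_smul, ← _root_.map_smul, sub_smul, one_smul, ← hRk, hab]
  have hr0' : r ≠ 0 := by
    rintro rfl
    rw [Complex.ofReal_zero, zero_smul, sub_zero, one_smul] at habk
    rw [← habk, zero_mul, hψ.toIsPLF.map_zero] at hbb
    exact hbb rfl
  have hr1' : r ≠ 1 := by
    rintro rfl
    rw [Complex.ofReal_one, one_smul, sub_self, zero_smul] at habk
    have h3 := h1 _ (star_mem (hbN k)) k
    rw [habk, mul_zero, hψ'.map_zero, eq_comm, mul_eq_zero] at h3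
    exact hbb (h3.resolve_left hlc)
  have hr2 : 0 < 1 - r := sub_pos.2 (lt_of_le_of_ne hr1 hr1')
  have hr3 : 0 < r := lt_of_le_of_ne hr0 hr0'.symm
  refine ⟨star (b k), star_mem (hbN k), l * r / (1 - r), by positivity, by rwa [star_star],
    fun x hx => ?_⟩
  have hr2c : (1 - r : ℂ) ≠ 0 := by exact_mod_cast hr2.ne'
  have h3 := congrArg (fun z => ψ' (star z * x)) habk
  simp only [star_smul, smul_mul_assoc] at h3
  rw [hψ'.map_smul _ _ (mul_mem (star_mem (haN k)) hx),
    hψ'.map_smul _ _ (mul_mem (star_mem (hbN k)) hx), h2 x hx] at h3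
  have h4 : star (1 - r : ℂ) = 1 - r := by simp
  have h5 : star (r : ℂ) = r := by simp
  rw [h4, h5] at h3
  push_cast
  field_simp
  linear_combination -h3

namespace VNAut

variable {M N : VonNeumannAlgebra H} {E : Op H → Op H} (Θ : VNAut M)

theorem inv_add {x y : Op H} (hx : x ∈ M) (hy : y ∈ M) :
    Θ.invFun (x + y) = Θ.invFun x + Θ.invFun y := by
  rw [← Θ.left_inv' _ (add_mem (Θ.inv_mem' x hx) (Θ.inv_mem' y hy)),
    Θ.map_add' _ (Θ.inv_mem' x hx) _ (Θ.inv_mem' y hy), Θ.right_inv' x hx, Θ.right_inv' y hy]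

theorem inv_smul (c : ℂ) {x : Op H} (hx : x ∈ M) : Θ.invFun (c • x) = c • Θ.invFun x := by
  rw [← Θ.left_inv' _ (smul_mem_vna M c (Θ.inv_mem' x hx)),
    Θ.map_smul' _ _ (Θ.inv_mem' x hx), Θ.right_inv' x hx]

theorem inv_mul {x y : Op H} (hx : x ∈ M) (hy : y ∈ M) :
    Θ.invFun (x * y) = Θ.invFun x * Θ.invFun y := by
  rw [← Θ.left_inv' _ (mul_mem (Θ.inv_mem' x hx) (Θ.inv_mem' y hy)),
    Θ.map_mul' _ (Θ.inv_mem' x hx) _ (Θ.inv_mem' y hy), Θ.right_inv' x hx, Θ.right_inv' y hy]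

theorem inv_star {x : Op H} (hx : x ∈ M) : Θ.invFun (star x) = star (Θ.invFun x) := by
  rw [← Θ.left_inv' _ (star_mem (Θ.inv_mem' x hx)), Θ.map_star' _ (Θ.inv_mem' x hx),
    Θ.right_inv' x hx]

variable {Θ}

theorem condExp_inv (hE : IsCondExp M N E) (h : ∀ x ∈ M, E (Θ.toFun x) = Θ.toFun (E x)) {x : Op H}
    (hx : x ∈ M) : E (Θ.invFun x) = Θ.invFun (E x) := by
  have hx' := Θ.inv_mem' x hx
  rw [← Θ.left_inv' _ (hE.subset' (hE.mem' _ hx')), ← h _ hx', Θ.right_inv' x hx]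

theorem toFun_mem_subalgebra (hE : IsCondExp M N E)
    (h : ∀ x ∈ M, E (Θ.toFun x) = Θ.toFun (E x)) {x : Op H} (hx : x ∈ N) : Θ.toFun x ∈ N := by
  rw [← hE.fix' x hx, ← h x (hE.subset' hx)]
  exact hE.mem' _ (Θ.mem' x (hE.subset' hx))

theorem invFun_mem_subalgebra (hE : IsCondExp M N E)
    (h : ∀ x ∈ M, E (Θ.toFun x) = Θ.toFun (E x)) {x : Op H} (hx : x ∈ N) : Θ.invFun x ∈ N := by
  rw [← hE.fix' x hx, ← condExp_inv hE h (hE.subset' hx)]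
  exact hE.mem' _ (Θ.inv_mem' x (hE.subset' hx))

theorem isPLF_inv {ψ : Op H → ℂ} (hψ : IsPLF N ψ) (hE : IsCondExp M N E)
    (h : ∀ x ∈ M, E (Θ.toFun x) = Θ.toFun (E x)) : IsPLF N (fun x => ψ (Θ.invFun x)) where
  map_add x hx y hy := by
    rw [Θ.inv_add (hE.subset' hx) (hE.subset' hy),
      hψ.map_add _ (invFun_mem_subalgebra hE h hx) _ (invFun_mem_subalgebra hE h hy)]
  map_smul c x hx := by
    rw [Θ.inv_smul c (hE.subset' hx), hψ.map_smul _ _ (invFun_mem_subalgebra hE h hx)]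
  pos x hx := by
    rw [Θ.inv_mul (star_mem (hE.subset' hx)) (hE.subset' hx), Θ.inv_star (hE.subset' hx)]
    exact hψ.pos _ (invFun_mem_subalgebra hE h hx)

theorem isSupportProjOf_inv {ψ : Op H → ℂ} {s : Op H} (hs : IsSupportProjOf N ψ s)
    (hE : IsCondExp M N E) (h : ∀ x ∈ M, E (Θ.toFun x) = Θ.toFun (E x)) :
    IsSupportProjOf N (fun x => ψ (Θ.invFun x)) (Θ.toFun s) := by
  obtain ⟨⟨hsN, hs1, hs2⟩, hs3, hs4⟩ := hs
  have hsM := hE.subset' hsN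
  refine ⟨⟨toFun_mem_subalgebra hE h hsN, ?_, ?_⟩, fun x hx => ?_, fun q hq hqψ => ?_⟩
  · rw [← Θ.map_star' s hsM, hs1]
  · rw [← Θ.map_mul' s hsM s hsM, hs2]
  · have hxM := hE.subset' hx
    change ψ _ = ψ _
    rw [Θ.inv_mul (mul_mem (Θ.mem' s hsM) hxM) (Θ.mem' s hsM), Θ.inv_mul (Θ.mem' s hsM) hxM,
      Θ.left_inv' s hsM, hs3 _ (invFun_mem_subalgebra hE h hx)]
  · obtain ⟨hqN, hq1, hq2⟩ := hq
    have hqM := hE.subset' hqN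
    have hq' := Θ.inv_mem' q hqM
    have h1 := hs4 (Θ.invFun q)
      ⟨invFun_mem_subalgebra hE h hqN, by rw [← Θ.inv_star hqM, hq1], by
        rw [← Θ.inv_mul hqM hqM, hq2]⟩ fun x hx => by
        have hxM := hE.subset' hx
        have h2 : ψ (Θ.invFun (q * Θ.toFun x * q)) = ψ (Θ.invFun (Θ.toFun x)) :=
          hqψ _ (toFun_mem_subalgebra hE h hx)
        rwa [Θ.inv_mul (mul_mem hqM (Θ.mem' x hxM)) hqM, Θ.inv_mul hqM (Θ.mem' x hxM),
          Θ.left_inv' x hxM] at h2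
    rw [← Θ.right_inv' q hqM, ← Θ.map_mul' s hsM _ hq', h1]

end VNAut

theorem IsSupportProjOf.apply_star_mul_ne_zero {M : VonNeumannAlgebra H} {ω : Op H → ℂ} {p v : Op H}
    (hω : IsPLF M ω) (hp : IsSupportProjOf M ω p) (hv : v ∈ M) (hvi : IsPartialIsom v)
    (hv0 : v ≠ 0) (hvp : v * p = v) : ω (star v * v) ≠ 0 := by
  intro h0
  obtain ⟨⟨hpM, hp1, hp2⟩, hp3, hp4⟩ := hp
  set e := star v * v with he
  have heM : e ∈ M := mul_mem (star_mem hv) hv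
  have hes : star e = e := by rw [he, star_mul, star_star]
  have hee : e * e = e := hvi
  have hep : e * p = e := by rw [he, mul_assoc, hvp]
  have hpe : p * e = e := by
    have := congrArg star hep
    rwa [star_mul, hp1, hes] at this
  have hrM : p - e ∈ M := sub_mem hpM heM
  have h1 := hp4 (p - e) ⟨hrM, by rw [star_sub, hp1, hes], by
    rw [sub_mul, mul_sub, mul_sub, hp2, hpe, hep, hee, sub_self, sub_zero]⟩ fun x hx => by
      have h2 : (p - e) * x * (p - e) = p * x * p - p * x * e - e * (x * (p - e)) := by
        noncomm_ring
      have hpx := mul_mem hpM hx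
      rw [h2, hω.map_sub (sub_mem (mul_mem hpx hpM) (mul_mem hpx heM))
        (mul_mem heM (mul_mem hx hrM)), hω.map_sub (mul_mem hpx hpM) (mul_mem hpx heM), hp3 x hx,
        hω.eq_zero_of_right hpx heM (by rw [hes, hee, h0]),
        hω.eq_zero_of_left heM (mul_mem hx hrM) (by rw [hes, hee, h0]), sub_zero, sub_zero]
  rw [mul_sub, hp2, hpe, sub_eq_self] at h1
  exact hv0 (CStarRing.star_mul_self_eq_zero_iff v |>.1 h1)

/-- Proposition 4.3.  Let `M = N ⊗̄ P` be a tensor product of von Neumann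
algebras, `φ_N`, `φ_P` faithful normal states and `φ_M = φ_N ⊗ φ_P`.  Then the triple
`(M, N, φ_M)`, with the slice conditional expectation `E = id_N ⊗ φ_P`, is
intertwining stable. -/
theorem tensor_intertwining_stable
    {H : Type} [NormedAddCommGroup H] [InnerProductSpace ℂ H] [CompleteSpace H]
    (M N P : VonNeumannAlgebra H) (hdec : IsTensorDecomposition M N P)
    (φN φP φM : Op H → ℂ)
    (hφN : IsFNState N φN) (hφP : IsFNState P φP) (hφM : IsFNState M φM)
    (hprod : ∀ x ∈ N, ∀ y ∈ P, φM (x * y) = φN x * φP y)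
    (E : Op H → Op H) (hE : IsSliceExpectation M N P φP E)
    (hEφ : ∀ x ∈ M, φM (E x) = φM x) :
    IntertwiningStable M N E φM := by
  intro Θ hΘ _ ψ hψ _ ⟨v, q, p, l, hl, hv, hvi, hv0, _, hp, _, hvp, hrel⟩
  have hψ' := VNAut.isPLF_inv hψ.toIsPLF hE.1 hΘ
  have hne := hp.apply_star_mul_ne_zero (hE.1.isPLF_comp hψ.toIsPLF) hv hvi hv0 hvp
  obtain ⟨a, ha, μ, hμ, ha0, h⟩ := exists_intertwiner_of_slice hdec hφN hφP hφM hprod hE hEφ hψ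
    hψ' hv hl (fun x hx => by
      rw [← VNAut.condExp_inv hE.1 hΘ (mul_mem hv hx)]
      exact hrel x hx) hne
  obtain ⟨s, hs⟩ := hψ.exists_support
  exact intertwined_of_exists hψ hψ' hμ (VNAut.isSupportProjOf_inv hs hE.1 hΘ) ha ha0 h

end HSC
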